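/- arXiv:1411.4795 — 3 statements merged into one kernel-verified Lean document; each statement's English description precedes it below -/
import Mathlib

section
/- Every weak*-local derivation on a von Neumann algebra is a derivation; i.e., the space of derivations on a von Neumann algebra is weak*-algebraically reflexive in the space of all linear maps. -/
open scoped ComplexOrder InnerProductSpace

variable {H : Type*} [NormedAddCommGroup H] [InnerProductSpace ℂ H] [CompleteSpace H]

instance : SMulMemClass (VonNeumannAlgebra H) ℂ (H →L[ℂ] H) :=
  ⟨fun {s} c {x} hx => s.toStarSubalgebra.smul_mem hx c⟩

/-- A normal state on `B(H)`, given in density-matrix form `φ(x) = ∑ ⟨x ξₙ, ξₙ⟩` with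
`∑ ‖ξₙ‖² = 1`.  The normal states of a von Neumann algebra `M ⊆ B(H)` are exactly the
restrictions to `M` of such functionals. -/
def IsNormalState (φ : (H →L[ℂ] H) → ℂ) : Prop :=
  ∃ ξ : ℕ → H, (∑' n, ‖ξ n‖ ^ 2) = 1 ∧ ∀ x : H →L[ℂ] H, φ x = ∑' n, ⟪ξ n, x (ξ n)⟫_ℂ

/-- A derivation on the von Neumann algebra `M`. -/
def IsDerivationOn (M : VonNeumannAlgebra H) (D : ↥M → ↥M) : Prop :=
  IsLinearMap ℂ D ∧ ∀ a b : ↥M, D (a * b) = D a * b + a * D b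

/-- A weak*-local derivation on the von Neumann algebra `M`: a linear map agreeing with some
derivation at each point, up to each normal state. -/
def IsWeakStarLocalDerivation (M : VonNeumannAlgebra H) (T : ↥M → ↥M) : Prop :=
  IsLinearMap ℂ T ∧ ∀ (a : ↥M) (φ : (H →L[ℂ] H) → ℂ), IsNormalState φ →
    ∃ D : ↥M → ↥M, IsDerivationOn M D ∧ φ ↑(T a) = φ ↑(D a)


/-! Part 1: Jordan derivations of semiprime complex algebras are derivations. -/

section JordanDer

variable {R : Type*} [Ring R] [Algebra ℂ R]

theorem two_cancel {x : R} (h : x + x = 0) : x = 0 := by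
  have h2 : (2 : ℂ) • x = 0 := by rw [two_smul]; exact h
  exact (smul_eq_zero.mp h2).resolve_left two_ne_zero

/-- In a semiprime ring, `a z b + b z a = 0` for all `z` forces `a z b = 0`. -/
theorem semiprime_aux (hs : ∀ u : R, (∀ w, u * w * u = 0) → u = 0) (a b : R)
    (h : ∀ z, a * z * b + b * z * a = 0) (z : R) : a * z * b = 0 := by
  apply hs
  intro y
  have e1 := h y
  have e2 := h (z * a * y)
  have e3 := h z
  apply two_cancel
  have i1 : a * z * b * y * (a * z * b) + a * z * a * y * b * z * b = 0 := by
    have : a * z * (a * y * b + b * y * a) * z * b = 0 := by rw [e1]; simp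
    rw [← this]; noncomm_ring
  have i2 : a * z * a * y * b * z * b + b * z * a * y * a * z * b = 0 := by
    have : (a * (z * a * y) * b + b * (z * a * y) * a) * z * b = 0 := by rw [e2]; simp
    rw [← this]; noncomm_ring
  have i3 : a * z * b * y * (a * z * b) + b * z * a * y * a * z * b = 0 := by
    have : (a * z * b + b * z * a) * y * a * z * b = 0 := by rw [e3]; simp
    rw [← this]; noncomm_ring
  have : a * z * b * y * (a * z * b) + a * z * b * y * (a * z * b) =
    (a * z * b * y * (a * z * b) + a * z * a * y * b * z * b)
    - (a * z * a * y * b * z * b + b * z * a * y * a * z * b)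
    + (a * z * b * y * (a * z * b) + b * z * a * y * a * z * b) := by abel
  rw [this, i1, i2, i3]; simp

theorem jordan_is_derivation (hs : ∀ u : R, (∀ w, u * w * u = 0) → u = 0)
    (d : R → R) (hadd : ∀ x y, d (x + y) = d x + d y)
    (hj : ∀ x y, d (x * y + y * x) = d x * y + x * d y + d y * x + y * d x) :
    ∀ x y, d (x * y) = d x * y + x * d y := by
  have hsub : ∀ x y, d (x - y) = d x - d y := by
    intro x y
    have := hadd (x - y) y
    rw [sub_add_cancel] at this
    rw [this]; abel
  have hd0 : d 0 = 0 := by simpa using hsub 0 0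
  -- triple product
  have h2 : ∀ x y, d (x * y * x) = d x * y * x + x * d y * x + x * y * d x := by
    intro x y
    have e1 := hj x (x * y + y * x)
    have e2 := hj (x * x) y
    have e3 := hj x x
    have e4 := hj x y
    rw [hadd] at e3
    have e3' : d (x * x) = d x * x + x * d x := by
      have : (d (x * x) - (d x * x + x * d x)) = 0 := by
        apply two_cancel
        have : d (x * x) - (d x * x + x * d x) + (d (x * x) - (d x * x + x * d x))
          = (d (x * x) + d (x * x)) - (d x * x + x * d x + d x * x + x * d x) := by abel
        rw [this, e3, sub_self]
      exact sub_eq_zero.mp this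
    rw [e4] at e1
    rw [e3'] at e2
    have e5 : x * (x * y + y * x) + (x * y + y * x) * x
        = (x * x * y + y * (x * x)) + (x * y * x + x * y * x) := by noncomm_ring
    rw [e5, hadd, hadd (x * y * x), e2] at e1
    rw [← sub_eq_zero]
    apply two_cancel
    rw [← sub_eq_zero] at e1
    rw [← e1]
    noncomm_ring
  have h3 : ∀ x y z, d (x * y * z + z * y * x) = d x * y * z + x * d y * z + x * y * d z
      + d z * y * x + z * d y * x + z * y * d x := by
    intro x y z
    have e1 := h2 (x + z) y
    have e2 := h2 x y
    have e3 := h2 z y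
    have e5 : (x + z) * y * (x + z) = (x * y * z + z * y * x) + (x * y * x + z * y * z) := by
      noncomm_ring
    rw [e5, hadd, hadd (x * y * x), e2, e3, hadd x z] at e1
    rw [← sub_eq_zero] at e1 ⊢
    rw [← e1]
    noncomm_ring
  set δ : R → R → R := fun x y => d (x * y) - d x * y - x * d y with hδ
  have hanti : ∀ x y, d (y * x) = d y * x + y * d x - δ x y := by
    intro x y
    have := hj x y
    rw [hadd] at this
    rw [← sub_eq_zero] at this ⊢
    rw [← this]
    simp only [hδ]
    noncomm_ring
  have hdxy : ∀ x y, d (x * y) = d x * y + x * d y + δ x y := by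
    intro x y; simp only [hδ]; noncomm_ring
  have h4 : ∀ x y z, δ x y * z * (x * y - y * x) + (x * y - y * x) * z * δ x y = 0 := by
    intro x y z
    have e1 := h2 x (y * z * y)
    have e2 := h2 y (x * z * x)
    have e3 := h3 (x * y) z (y * x)
    rw [h2 y z] at e1
    rw [h2 x z] at e2
    rw [hanti x y, hdxy x y] at e3
    have e5 : x * y * z * (y * x) + y * x * z * (x * y)
      = x * (y * z * y) * x + y * (x * z * x) * y := by noncomm_ring
    rw [e5, hadd, e1, e2] at e3
    rw [← sub_eq_zero] at e3
    rw [← e3]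
    generalize δ x y = D
    noncomm_ring
  have h5 : ∀ x y z, δ x y * z * (x * y - y * x) = 0 := fun x y =>
    semiprime_aux hs _ _ (h4 x y)
  have h5' : ∀ x y z, (x * y - y * x) * z * δ x y = 0 := by
    intro x y z
    have := h4 x y z
    rwa [h5, zero_add] at this
  have δl : ∀ x u y, δ (x + u) y = δ x y + δ u y := by
    intro x u y; simp only [hδ, add_mul, hadd]; abel
  have δr : ∀ x y v, δ x (y + v) = δ x y + δ x v := by
    intro x u y; simp only [hδ, mul_add, hadd]; abel
  have h6 : ∀ x y u z, δ x y * z * (u * y - y * u) = 0 := by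
    intro x y u z
    have e : ∀ z, δ x y * z * (u * y - y * u) = - (δ u y * z * (x * y - y * x)) := by
      intro z
      have a1 := h5 (x + u) y z
      have a2 := h5 x y z
      have a3 := h5 u y z
      rw [δl] at a1
      have : (δ x y + δ u y) * z * ((x + u) * y - y * (x + u)) =
        δ x y * z * (x * y - y * x) + δ u y * z * (u * y - y * u)
        + (δ x y * z * (u * y - y * u) + δ u y * z * (x * y - y * x)) := by noncomm_ring
      rw [this, a2, a3, add_zero, zero_add] at a1
      exact eq_neg_of_add_eq_zero_left a1
    apply hs
    intro w
    have : δ x y * z * (u * y - y * u) * w * (δ x y * z * (u * y - y * u))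
      = - (δ x y * z * ((u * y - y * u) * w * δ u y) * z * (x * y - y * x)) := by
      rw [e z]
      have := e z
      calc _ = - (δ u y * z * (x * y - y * x)) * w * - (δ u y * z * (x * y - y * x)) := rfl
        _ = (δ x y * z * (u * y - y * u)) * w * - (δ u y * z * (x * y - y * x)) := by rw [← e z]
        _ = _ := by noncomm_ring
    rw [this, h5']; simp
  have h6' : ∀ x y u z, (u * y - y * u) * z * δ x y = 0 := by
    intro x y u z
    apply hs
    intro w
    calc _ = (u * y - y * u) * z * (δ x y * w * (u * y - y * u)) * z * δ x y := by noncomm_ring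
      _ = 0 := by rw [h6]; simp
  have h7 : ∀ x y u v z, δ x y * z * (u * v - v * u) = 0 := by
    intro x y u v z
    have e : ∀ z, δ x y * z * (u * v - v * u) = - (δ x v * z * (u * y - y * u)) := by
      intro z
      have a1 := h6 x (y + v) u z
      have a2 := h6 x y u z
      have a3 := h6 x v u z
      rw [δr] at a1
      have : (δ x y + δ x v) * z * (u * (y + v) - (y + v) * u) =
        δ x y * z * (u * y - y * u) + δ x v * z * (u * v - v * u)
        + (δ x y * z * (u * v - v * u) + δ x v * z * (u * y - y * u)) := by noncomm_ring
      rw [this, a2, a3, add_zero, zero_add] at a1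
      exact eq_neg_of_add_eq_zero_left a1
    apply hs
    intro w
    calc δ x y * z * (u * v - v * u) * w * (δ x y * z * (u * v - v * u))
        = δ x y * z * (u * v - v * u) * w * (- (δ x v * z * (u * y - y * u))) := by rw [e z]
      _ = - (δ x y * z * ((u * v - v * u) * w * δ x v) * z * (u * y - y * u)) := by noncomm_ring
      _ = 0 := by rw [h6']; simp
  have h8 : ∀ x y v, δ x y * v - v * δ x y = 0 := by
    intro x y v
    apply hs
    intro w
    calc (δ x y * v - v * δ x y) * w * (δ x y * v - v * δ x y)
        = δ x y * (v * w) * (δ x y * v - v * δ x y)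
          - v * (δ x y * w * (δ x y * v - v * δ x y)) := by noncomm_ring
      _ = 0 := by rw [h7, h7]; simp
  intro x y
  have hc : ∀ v, δ x y * v = v * δ x y := fun v => sub_eq_zero.mp (h8 x y v)
  have hcomm : ∀ u v, δ x y * (u * v - v * u) = 0 := fun u v => by
    simpa using h7 x y u v 1
  have k1 : δ x y + δ x y = d (x * y - y * x) - (d x * y - y * d x) - (x * d y - d y * x) := by
    rw [hsub, hdxy x y, hanti x y]; abel
  have k2 : δ x y * (δ x y + δ x y) = δ x y * d (x * y - y * x) := by
    rw [k1, mul_sub, mul_sub, hcomm, hcomm]; simp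
  have k3 : δ x y * d (x * y - y * x) + δ x y * d (x * y - y * x)
      = - (d (δ x y) * (x * y - y * x) + (x * y - y * x) * d (δ x y)) := by
    have := hj (δ x y) (x * y - y * x)
    rw [← hc (x * y - y * x), hcomm, add_zero, hd0, ← hc (d (x * y - y * x))] at this
    rw [← sub_eq_zero, this]; abel
  have k4 : δ x y * (δ x y * d (x * y - y * x)) = 0 := by
    apply two_cancel
    rw [← mul_add, k3, mul_neg, mul_add, ← mul_assoc, h7, ← mul_assoc, hcomm]; simp
  have k5 : δ x y * δ x y * δ x y = 0 := by
    apply two_cancel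
    rw [← k2] at k4
    rw [← k4]; noncomm_ring
  have k6 : δ x y * δ x y = 0 := by
    apply hs
    intro w
    calc δ x y * δ x y * w * (δ x y * δ x y) = δ x y * (δ x y * w) * (δ x y * δ x y) := by
          noncomm_ring
      _ = (δ x y * w * δ x y) * (δ x y * δ x y) := by rw [hc (δ x y * w)]
      _ = δ x y * w * (δ x y * δ x y * δ x y) := by noncomm_ring
      _ = 0 := by rw [k5]; simp
  have k7 : δ x y = 0 := by
    apply hs
    intro w
    rw [hc w, mul_assoc, k6]; simp
  rw [hdxy, k7, add_zero]

end JordanDer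

section OffDiag

open Complex in
theorem poly_coeff {V : Type*} [AddCommGroup V] [Module ℂ V]
    (m00 A B m20 m02 m11 m21 m12 m22 : V)
    (h : ∀ l : ℂ, m00 + l • A + (star l) • B + (l * l) • m20 + (star l * star l) • m02
      + (l * star l) • m11 + (l * l * star l) • m21 + (l * star l * star l) • m12
      + (l * l * star l * star l) • m22 = 0) : A = 0 ∧ B = 0 := by
  have key : ∀ u : ℂ, u • A + star u • B = 0 := by
    intro u
    have h1 := h u
    have h2 := h (-u)
    have h3 := h (2 * u)
    have h4 := h (-(2 * u))
    simp only [star_neg, star_mul', star_ofNat] at h1 h2 h3 h4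
    generalize star u = v at *
    linear_combination (norm := module) (8 / 12 : ℂ) • h1 - (8 / 12 : ℂ) • h2
      - (1 / 12 : ℂ) • h3 + (1 / 12 : ℂ) • h4
  have k1 := key 1
  have k2 := key I
  have k3 : A - B = 0 := by
    have : I • (A - B) = 0 := by
      rw [← k2]; simp [sub_eq_add_neg]
    exact (smul_eq_zero.mp this).resolve_left I_ne_zero
  simp only [star_one, one_smul] at k1
  constructor
  · linear_combination (norm := module) (1 / 2 : ℂ) • k1 + (1 / 2 : ℂ) • k3
  · linear_combination (norm := module) (1 / 2 : ℂ) • k1 - (1 / 2 : ℂ) • k3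

variable {A : Type*} [CStarAlgebra A]

theorem offdiag_aux (T : A →ₗ[ℂ] A)
    (hK : ∀ c x : A, x * c = 0 → star c * x = 0 → star c * T x * c = 0)
    (p : A) (hps : star p = p) (hpp : p * p = p) (a : A) (hpa : p * a = a) (hap : a * p = a)
    (w : A) (hpw : p * w = w) (hwp : w * p = 0) :
    (1 - p) * T (a * w) * (1 - p) = (1 - p) * T a * w ∧
    (1 - p) * T (star w * a) * (1 - p) = star w * T a * (1 - p) := by
  have hww : w * w = 0 := by
    calc w * w = w * (p * w) := by rw [hpw]
      _ = (w * p) * w := by noncomm_ring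
      _ = 0 := by rw [hwp, zero_mul]
  have hsw : star w * p = star w := by
    rw [← hps, ← star_mul, hpw]
  have hpsw : p * star w = 0 := by
    rw [← hps, ← star_mul, hwp, star_zero]
  have z1 : ∀ l : ℂ, (p + l • w) * ((1 - p) - l • w) = 0 := by
    intro l
    simp only [mul_sub, add_mul, mul_one, hpp, smul_mul_assoc, mul_smul_comm, hwp, hpw, hww]
    simp
  have main := poly_coeff ((1 - p) * T a * (1 - p))
    ((1 - p) * T (a * w) * (1 - p) - (1 - p) * T a * w)
    ((1 - p) * T (star w * a) * (1 - p) - star w * T a * (1 - p))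
    (- ((1 - p) * T (a * w) * w)) (- (star w * T (star w * a) * (1 - p)))
    ((1 - p) * T (star w * a * w) * (1 - p) - (1 - p) * T (star w * a) * w
      - star w * T (a * w) * (1 - p) + star w * T a * w)
    (star w * T (a * w) * w - (1 - p) * T (star w * a * w) * w)
    (star w * T (star w * a) * w - star w * T (star w * a * w) * (1 - p))
    (star w * T (star w * a * w) * w) (by
      intro l
      have hx1 : (star (p + l • w) * a * (p + l • w)) * ((1 - p) - l • w) = 0 := by
        rw [mul_assoc, z1, mul_zero]
      have hx2 : star ((1 - p) - l • w) * (star (p + l • w) * a * (p + l • w)) = 0 := by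
        rw [mul_assoc (star (p + l • w)), ← mul_assoc (star ((1 - p) - l • w)), ← star_mul, z1,
          star_zero, zero_mul]
      have hx := hK _ _ hx1 hx2
      have e : star (p + l • w) * a * (p + l • w) = a + l • (a * w) + star l • (star w * a)
          + (l * star l) • (star w * a * w) := by
        simp only [star_add, star_smul, hps, add_mul, mul_add, hpa, hap, smul_mul_assoc,
          mul_smul_comm, smul_add, smul_smul, mul_assoc]
        rw [mul_comm l]
        module
      rw [e] at hx
      simp only [map_add, map_smul, star_sub, star_one, hps, star_smul] at hx
      rw [← hx]
      generalize star l = l'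
      generalize 1 - p = q
      simp only [sub_mul, mul_sub, add_mul, mul_add, smul_mul_assoc, mul_smul_comm, smul_smul,
        smul_sub, smul_add]
      module)
  exact ⟨sub_eq_zero.mp main.1, sub_eq_zero.mp main.2⟩

theorem offdiag (T : A →ₗ[ℂ] A)
    (hK : ∀ c x : A, x * c = 0 → star c * x = 0 → star c * T x * c = 0)
    (p : A) (hps : star p = p) (hpp : p * p = p) (a : A) (hpa : p * a = a) (hap : a * p = a) :
    (1 - p) * T a * p = (1 - p) * T p * a ∧ p * T a * (1 - p) = a * T p * (1 - p) := by
  have hqp : (1 - p) * p = 0 := by rw [sub_mul, hpp]; simp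
  have hpq : p * (1 - p) = 0 := by rw [mul_sub, hpp]; simp
  have hqs : star (1 - p) = 1 - p := by rw [star_sub, hps, star_one]
  constructor
  · set Y := (1 - p) * T a * p - (1 - p) * T p * a with hY
    have hYp : Y * p = Y := by
      rw [hY, sub_mul, mul_assoc _ p p, hpp, mul_assoc _ a p, hap]
    have hpY : p * Y = 0 := by
      rw [hY, mul_sub]; simp only [← mul_assoc]; rw [hpq]; simp
    have hw1 : p * star Y = star Y := by
      calc p * star Y = star (Y * p) := by rw [star_mul, hps]
        _ = _ := by rw [hYp]
    have hw2 : star Y * p = 0 := by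
      calc star Y * p = star (p * Y) := by rw [star_mul, hps]
        _ = _ := by rw [hpY, star_zero]
    have e1 := (offdiag_aux T hK p hps hpp a hpa hap (star Y) hw1 hw2).1
    have e2 := (offdiag_aux T hK p hps hpp p hpp hpp (a * star Y)
      (by rw [← mul_assoc, hpa]) (by rw [mul_assoc, hw2, mul_zero])).1
    rw [← mul_assoc p, hpa] at e2
    have e3 : Y * star Y = 0 := by
      rw [hY, sub_mul, ← hY, mul_assoc _ p, hw1, ← e1, e2]
      simp [mul_assoc]
    have := (CStarRing.mul_star_self_eq_zero_iff Y).mp e3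
    exact sub_eq_zero.mp this
  · set Y := p * T a * (1 - p) - a * T p * (1 - p) with hY
    have hw1 : p * Y = Y := by
      rw [hY, mul_sub]; simp only [← mul_assoc]; rw [hpp, hpa]
    have hw2 : Y * p = 0 := by
      rw [hY, sub_mul, mul_assoc, hqp, mul_assoc _ _ p, hqp]; simp
    have e1 := (offdiag_aux T hK p hps hpp a hpa hap Y hw1 hw2).2
    have e2 := (offdiag_aux T hK p hps hpp p hpp hpp (star a * Y)
      (by rw [← mul_assoc]; congr 1; rw [← hps, ← star_mul, hap])
      (by rw [mul_assoc, hw2, mul_zero])).2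
    have hsY : star Y * p = star Y := by
      calc star Y * p = star (p * Y) := by rw [star_mul, hps]
        _ = _ := by rw [hw1]
    rw [star_mul, star_star, mul_assoc (star Y) a p, hap] at e2
    have e3 : star Y * Y = 0 := by
      calc star Y * Y = (star Y * p) * T a * (1 - p) - star Y * a * T p * (1 - p) := by
            rw [hY, mul_sub]; simp only [mul_assoc]
        _ = 0 := by rw [hsY, ← e1, e2, sub_self]
    have := (CStarRing.star_mul_self_eq_zero_iff Y).mp e3
    exact sub_eq_zero.mp this

/-- The Jordan defect of `a` commutes with every projection commuting with `a`. -/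
theorem defect_commute (T : A →ₗ[ℂ] A) (hT1 : T 1 = 0)
    (hK : ∀ c x : A, x * c = 0 → star c * x = 0 → star c * T x * c = 0)
    (r : A) (hrs : star r = r) (hrr : r * r = r) (a : A) (hra : r * a = a * r) :
    r * (T (a * a) - a * T a - T a * a) = (T (a * a) - a * T a - T a * a) * r := by
  have half : ∀ r : A, star r = r → r * r = r → r * a = a * r →
      r * (T (a * a) - a * T a - T a * a) * (1 - r) = 0 := by
    intro r hrs hrr hra
    have hqs : star (1 - r) = 1 - r := by rw [star_sub, hrs, star_one]
    have hqq : (1 - r) * (1 - r) = 1 - r := by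
      rw [sub_mul, mul_sub, mul_sub, hrr]; simp
    have F : ∀ x : A, r * x = x * r → r * T x * (1 - r) = x * (r * T r * (1 - r))
        - (r * T r * (1 - r)) * x := by
      intro x hx
      have hqx : (1 - r) * x = x * (1 - r) := by rw [sub_mul, mul_sub, hx]; simp
      have o1 := (offdiag T hK r hrs hrr (r * x) (by rw [← mul_assoc, hrr])
        (by rw [mul_assoc, ← hx, ← mul_assoc, hrr])).2
      have o2 := (offdiag T hK (1 - r) hqs hqq ((1 - r) * x) (by rw [← mul_assoc, hqq])
        (by rw [mul_assoc, ← hqx, ← mul_assoc, hqq])).1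
      rw [sub_sub_cancel] at o2
      have hTq : T (1 - r) = - T r := by rw [map_sub, hT1, zero_sub]
      have hxs : x = r * x + (1 - r) * x := by noncomm_ring
      calc r * T x * (1 - r) = r * T (r * x) * (1 - r) + r * T ((1 - r) * x) * (1 - r) := by
            conv_lhs => rw [hxs, map_add]
            noncomm_ring
        _ = r * x * T r * (1 - r) + r * (- T r) * ((1 - r) * x) := by rw [o1, o2, hTq]
        _ = _ := by rw [hx]; noncomm_ring
    have f1 := F a hra
    have f2 := F (a * a) (by rw [← mul_assoc, hra, mul_assoc, hra, mul_assoc])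
    have hqa : (1 - r) * a = a * (1 - r) := by rw [sub_mul, mul_sub, hra]; simp
    calc r * (T (a * a) - a * T a - T a * a) * (1 - r)
        = r * T (a * a) * (1 - r) - (r * a) * T a * (1 - r) - r * T a * (a * (1 - r)) := by
          noncomm_ring
      _ = r * T (a * a) * (1 - r) - a * (r * T a * (1 - r)) - (r * T a * (1 - r)) * a := by
          rw [hra, ← hqa]; noncomm_ring
      _ = 0 := by rw [f1, f2]; noncomm_ring
  have h1 := half r hrs hrr hra
  have h2 := half (1 - r) (by rw [star_sub, hrs, star_one])
    (by rw [sub_mul, mul_sub, mul_sub, hrr]; simp) (by rw [sub_mul, mul_sub, hra]; simp)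
  rw [sub_sub_cancel] at h2
  generalize T (a * a) - a * T a - T a * a = D at *
  have e1 : r * D = r * D * r := by
    rw [mul_sub, mul_one] at h1; exact sub_eq_zero.mp h1
  have e2 : D * r = r * D * r := by
    rw [sub_mul, sub_mul, one_mul] at h2; exact sub_eq_zero.mp h2
  rw [e1, e2]

end OffDiag

section Hump

variable {H : Type*} [NormedAddCommGroup H] [InnerProductSpace ℂ H] [CompleteSpace H]
variable {A : Type*} [CStarAlgebra A]

theorem proj_norm_le_one {v : A} (hs : star v = v) (hv : v * v = v) : ‖v‖ ≤ 1 := by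
  have h := CStarRing.norm_star_mul_self (x := v)
  rw [hs, hv] at h
  by_contra hc
  push Not at hc
  nlinarith

theorem hump (π : A →⋆ₐ[ℂ] (H →L[ℂ] H)) (hπ : ∀ x, ‖π x‖ = ‖x‖) (T : A →ₗ[ℂ] A)
    (hK : ∀ c x : A, x * c = 0 → star c * x = 0 → star c * T x * c = 0)
    (x : A) (v : ℝ → A) (C : ℝ) (hC : 0 ≤ C)
    (hvs : ∀ γ, 0 < γ → star (v γ) = v γ)
    (hvv : ∀ γ δ, 0 < δ → δ ≤ γ → v γ * v δ = v δ)
    (hvx : ∀ γ, 0 < γ → x * v γ = v γ * x)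
    (hxv : ∀ γ, 0 < γ → ‖x * v γ‖ ≤ C * γ)
    (hlim : ∀ (ξ : H) (ε : ℝ), 0 < ε → ∃ γ₀ > 0, ∀ γ, 0 < γ → γ ≤ γ₀ → ‖π (v γ) ξ‖ ≤ ε)
    (ε : ℝ) (hε : 0 < ε) :
    ∃ γ > 0, ∀ δ, 0 < δ → δ ≤ γ → ‖v δ * T x * v δ‖ ≤ ε := by
  have hvv' : ∀ γ δ, 0 < δ → δ ≤ γ → v δ * v γ = v δ := by
    intro γ δ h1 h2
    have := congrArg star (hvv γ δ h1 h2)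
    rwa [star_mul, hvs δ h1, hvs γ (h1.trans_le h2)] at this
  have hv1 : ∀ γ, 0 < γ → ‖v γ‖ ≤ 1 := fun γ h =>
    proj_norm_le_one (hvs γ h) (hvv γ γ h le_rfl)
  by_contra hcon
  push Not at hcon
  have hbig : ∀ γ, 0 < γ → ε < ‖v γ * T x * v γ‖ := by
    intro γ hγ
    obtain ⟨δ, hδ, hδγ, h⟩ := hcon γ hγ
    have e : v δ * T x * v δ = v δ * (v γ * T x * v γ) * v δ := by
      calc v δ * T x * v δ = (v δ * v γ) * T x * (v γ * v δ) := by
            rw [hvv γ δ hδ hδγ, hvv' γ δ hδ hδγ]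
        _ = _ := by noncomm_ring
    rw [e] at h
    have h1 : ‖v δ * (v γ * T x * v γ) * v δ‖ ≤ ‖v δ‖ * ‖v γ * T x * v γ‖ * ‖v δ‖ :=
      (norm_mul_le _ _).trans (mul_le_mul_of_nonneg_right (norm_mul_le _ _) (norm_nonneg _))
    have h2 := hv1 δ hδ
    have h3 : ‖v δ‖ * ‖v γ * T x * v γ‖ * ‖v δ‖ ≤ 1 * ‖v γ * T x * v γ‖ * 1 := by gcongr
    linarith
  -- pieces
  have hpiece : ∀ γ, 0 < γ → ∃ δ, 0 < δ ∧ δ ≤ γ / 8 ∧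
      ε / 2 ≤ ‖(v γ - v δ) * T x * (v γ - v δ)‖ := by
    intro γ hγ
    have : ∃ ξ : H, ε * ‖ξ‖ < ‖π (v γ * T x * v γ) ξ‖ := by
      by_contra hno
      push Not at hno
      have := ContinuousLinearMap.opNorm_le_bound _ hε.le hno
      rw [hπ] at this
      exact absurd (hbig γ hγ) (not_lt.mpr this)
    obtain ⟨ξ, hξ⟩ := this
    have hξ0 : 0 < ‖ξ‖ := by
      rcases eq_or_ne ξ 0 with h | h
      · simp [h] at hξ
      · exact norm_pos_iff.mpr h
    set K := ‖T x‖ with hKdef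
    have hK0 : 0 ≤ K := norm_nonneg _
    obtain ⟨γ1, hγ1, hl1⟩ := hlim (π (T x * v γ) ξ) (ε * ‖ξ‖ / 4) (by positivity)
    obtain ⟨γ2, hγ2, hl2⟩ := hlim ξ (ε * ‖ξ‖ / (4 * (K + 1))) (by positivity)
    set δ := min (γ / 8) (min γ1 γ2) with hδ
    have hδ0 : 0 < δ := by positivity
    have hδ8 : δ ≤ γ / 8 := min_le_left _ _
    have hδ1 : δ ≤ γ1 := (min_le_right _ _).trans (min_le_left _ _)
    have hδ2 : δ ≤ γ2 := (min_le_right _ _).trans (min_le_right _ _)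
    refine ⟨δ, hδ0, hδ8, ?_⟩
    have hδγ : δ ≤ γ := by linarith
    have b1 := hl1 δ hδ0 hδ1
    have b2 := hl2 δ hδ0 hδ2
    set t := v γ - v δ with ht
    have hts : star t = t := by rw [ht, star_sub, hvs γ hγ, hvs δ hδ0]
    have htt : t * t = t := by
      rw [ht, sub_mul, mul_sub, mul_sub, hvv γ γ hγ le_rfl, hvv δ δ hδ0 le_rfl,
        hvv γ δ hδ0 hδγ, hvv' γ δ hδ0 hδγ]; abel
    have ht1 := proj_norm_le_one hts htt
    have e : t * T x * t = v γ * T x * v γ - v δ * (T x * v γ) - t * T x * v δ := by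
      rw [ht]; noncomm_ring
    have e' : π (v γ * T x * v γ) ξ = π (t * T x * t) ξ + π (v δ) (π (T x * v γ) ξ)
        + π (t * T x) (π (v δ) ξ) := by
      have : v γ * T x * v γ = t * T x * t + v δ * (T x * v γ) + t * T x * v δ := by
        rw [e]; abel
      rw [this, map_add, map_add, map_mul π (v δ), map_mul π (t * T x) (v δ)]
      rfl
    have n1 : ‖π (t * T x) (π (v δ) ξ)‖ ≤ K * (ε * ‖ξ‖ / (4 * (K + 1))) := by
      refine ((π (t * T x)).le_opNorm _).trans ?_
      rw [hπ]
      have : ‖t * T x‖ ≤ K := (norm_mul_le _ _).trans (by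
        calc ‖t‖ * ‖T x‖ ≤ 1 * ‖T x‖ := by gcongr
          _ = K := one_mul _)
      gcongr
    have n2 : K * (ε * ‖ξ‖ / (4 * (K + 1))) ≤ ε * ‖ξ‖ / 4 := by
      rw [mul_div_assoc', div_le_div_iff₀ (by positivity) (by positivity)]
      nlinarith [mul_pos hε hξ0]
    have n3 : ‖π (t * T x * t) ξ‖ ≤ ‖t * T x * t‖ * ‖ξ‖ := by
      rw [← hπ]; exact (π (t * T x * t)).le_opNorm _
    have n4 : ‖π (v γ * T x * v γ) ξ‖ ≤ ‖π (t * T x * t) ξ‖ + ‖π (v δ) (π (T x * v γ) ξ)‖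
        + ‖π (t * T x) (π (v δ) ξ)‖ := by
      rw [e']; exact norm_add₃_le
    have : (ε / 2) * ‖ξ‖ < ‖t * T x * t‖ * ‖ξ‖ := by linarith
    exact (lt_of_mul_lt_mul_right this hξ0.le).le
  choose! nx hnx0 hnx8 hnxb using hpiece
  set g : ℕ → ℝ := fun k => nx^[k] 1 with hg
  have hgs : ∀ k, g (k + 1) = nx (g k) := fun k => Function.iterate_succ_apply' nx k 1
  have hg0 : ∀ k, 0 < g k := by
    intro k
    induction k with
    | zero => simp [hg]
    | succ k ih => rw [hgs]; exact hnx0 _ ih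
  have hg8 : ∀ k, g (k + 1) ≤ g k / 8 := fun k => by rw [hgs]; exact hnx8 _ (hg0 k)
  have hgpow : ∀ k, g k ≤ (1 / 8 : ℝ) ^ k := by
    intro k
    induction k with
    | zero => simp [hg]
    | succ k ih => rw [pow_succ]; linarith [hg8 k]
  have hganti : Antitone g := antitone_nat_of_succ_le (fun k => by linarith [hg8 k, hg0 k])
  set t : ℕ → A := fun k => v (g k) - v (g (k + 1)) with ht
  have hts : ∀ k, star (t k) = t k := fun k => by
    simp only [ht, star_sub, hvs _ (hg0 k), hvs _ (hg0 (k + 1))]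
  have V : ∀ j k, j ≤ k → v (g j) * v (g k) = v (g k) := fun j k h =>
    hvv _ _ (hg0 k) (hganti h)
  have V' : ∀ j k, j ≤ k → v (g k) * v (g j) = v (g k) := fun j k h =>
    hvv' _ _ (hg0 k) (hganti h)
  have htt : ∀ k, t k * t k = t k := fun k => by
    simp only [ht, sub_mul, mul_sub]
    rw [V k k le_rfl, V (k+1) (k+1) le_rfl, V k (k+1) (by omega), V' k (k+1) (by omega)]; abel
  have htjk : ∀ j k, j < k → t j * t k = 0 := fun j k h => by
    simp only [ht, sub_mul, mul_sub]
    rw [V j k h.le, V j (k+1) (by omega), V (j+1) k (by omega), V (j+1) (k+1) (by omega)]; abel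
  have htne : ∀ j k, j ≠ k → t j * t k = 0 := fun j k h => by
    rcases lt_or_gt_of_ne h with h | h
    · exact htjk j k h
    · have := congrArg star (htjk k j h)
      rwa [star_mul, hts, hts, star_zero] at this
  have ht1 : ∀ k, ‖t k‖ ≤ 1 := fun k => proj_norm_le_one (hts k) (htt k)
  have htx : ∀ k, x * t k = t k * x := fun k => by
    simp only [ht, mul_sub, sub_mul, hvx _ (hg0 k), hvx _ (hg0 (k + 1))]
  have hxt : ∀ k, ‖x * t k‖ ≤ C * (1 / 8 : ℝ) ^ k := fun k => by
    have e : x * t k = (x * v (g k)) * t k := by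
      rw [mul_assoc]; congr 1
      simp only [ht, mul_sub]
      rw [V k k le_rfl, V k (k+1) (by omega)]
    rw [e]
    calc ‖x * v (g k) * t k‖ ≤ ‖x * v (g k)‖ * ‖t k‖ := norm_mul_le _ _
      _ ≤ (C * g k) * 1 :=
          mul_le_mul (hxv _ (hg0 k)) (ht1 k) (norm_nonneg _) (mul_nonneg hC (hg0 k).le)
      _ ≤ C * (1 / 8 : ℝ) ^ k := by rw [mul_one]; gcongr; exact hgpow k
  have hnt : ∀ k, ε / 2 ≤ ‖t k * T x * t k‖ := fun k => by
    have h2 := hnxb (g k) (hg0 k)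
    rwa [← hgs] at h2
  clear_value t
  set f : ℕ → A := fun k => ((4 : ℂ) ^ k) • (x * t k) with hf
  have hfn : ∀ k, ‖f k‖ ≤ C * (1 / 2 : ℝ) ^ k := fun k => by
    simp only [hf, norm_smul, norm_pow]
    calc ‖(4 : ℂ)‖ ^ k * ‖x * t k‖ ≤ (4 : ℝ) ^ k * (C * (1 / 8 : ℝ) ^ k) := by
          gcongr
          · simp
          · exact hxt k
      _ = C * (4 * (1 / 8) : ℝ) ^ k := by rw [mul_pow]; ring
      _ = _ := by norm_num
  have hsum : Summable f := by
    refine Summable.of_norm_bounded (g := fun k => C * (1 / 2 : ℝ) ^ k) ?_ hfn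
    exact (summable_geometric_of_lt_one (by norm_num) (by norm_num)).mul_left C
  set b := ∑' k, f k with hb
  have htb : ∀ k, t k * b = f k := fun k => by
    rw [hb, ← hsum.tsum_mul_left, tsum_eq_single k]
    · simp only [hf, mul_smul_comm]; rw [htx, ← mul_assoc, htt]
    · intro j hj
      simp only [hf, mul_smul_comm]; rw [htx, ← mul_assoc, htne k j hj.symm]; simp
  have hbt : ∀ k, b * t k = f k := fun k => by
    rw [hb, ← hsum.tsum_mul_right, tsum_eq_single k]
    · simp only [hf, smul_mul_assoc]; rw [mul_assoc, htt]
    · intro j hj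
      simp only [hf, smul_mul_assoc]; rw [mul_assoc, htne j k hj]; simp
  have hft : ∀ k, f k * t k = f k ∧ t k * f k = f k := fun k => by
    constructor
    · simp only [hf, smul_mul_assoc]; rw [mul_assoc, htt]
    · simp only [hf, mul_smul_comm]; rw [htx, ← mul_assoc, htt]
  have key : ∀ k, t k * T b * t k = ((4 : ℂ) ^ k) • (t k * T x * t k) := fun k => by
    have h1 := hK (t k) (b - f k) (by rw [sub_mul, hbt, (hft k).1, sub_self])
      (by rw [hts, mul_sub, htb, (hft k).2, sub_self])
    have h2 := hK (t k) (x - x * t k) (by rw [sub_mul, mul_assoc, htt, sub_self])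
      (by rw [hts, mul_sub, htx, ← mul_assoc, htt, sub_self])
    rw [hts, map_sub, mul_sub, sub_mul, sub_eq_zero] at h1 h2
    rw [h1, h2]
    simp only [hf, map_smul, mul_smul_comm, smul_mul_assoc]
  have hfin : ∀ k, (4 : ℝ) ^ k * (ε / 2) ≤ ‖T b‖ := fun k => by
    have h1 : ‖t k * T b * t k‖ ≤ ‖T b‖ := by
      calc _ ≤ ‖t k‖ * ‖T b‖ * ‖t k‖ :=
            (norm_mul_le _ _).trans (mul_le_mul_of_nonneg_right (norm_mul_le _ _) (norm_nonneg _))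
        _ ≤ 1 * ‖T b‖ * 1 := by gcongr <;> exact ht1 k
        _ = _ := by ring
    rw [key, norm_smul, norm_pow] at h1
    have h2 := hnt k
    refine le_trans ?_ h1
    have : ‖(4 : ℂ)‖ = 4 := by simp
    rw [this]
    gcongr
  obtain ⟨k, hk⟩ := pow_unbounded_of_one_lt (‖T b‖ / (ε / 2)) (by norm_num : (1 : ℝ) < 4)
  rw [div_lt_iff₀ (by positivity)] at hk
  exact absurd (hfin k) (not_le.mpr hk)

end Hump

section Diag

variable {H : Type*} [NormedAddCommGroup H] [InnerProductSpace ℂ H] [CompleteSpace H]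
variable {A : Type*} [CStarAlgebra A]

/-- `N` is the projection onto the kernel of `y` (in a faithful representation `π`). -/
structure IsNullProj (π : A →⋆ₐ[ℂ] (H →L[ℂ] H)) (y N : A) : Prop where
  sa : star N = N
  idem : N * N = N
  null : y * N = 0
  univ : ∀ z, y * z = 0 → N * z = z
  dens : ∀ (ξ : H) (ε : ℝ), 0 < ε → ∃ η : H, ‖π (1 - N) ξ - π y η‖ < ε

theorem IsNullProj.comm {π : A →⋆ₐ[ℂ] (H →L[ℂ] H)} {y N : A} (h : IsNullProj π y N)
    {g : A} (hg : star g = g) (hgy : g * y = y * g) : g * N = N * g := by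
  have e1 : N * (g * N) = g * N := h.univ _ (by rw [← mul_assoc, ← hgy, mul_assoc, h.null, mul_zero])
  have e2 := congrArg star e1
  simp only [star_mul, h.sa, hg] at e2
  rw [← e1, ← mul_assoc]; exact e2

/-- The cut-off function. -/
noncomputable def cutf (γ t : ℝ) : ℝ := max (|t| - γ) 0

theorem cutf_cont (γ : ℝ) : Continuous (cutf γ) := by unfold cutf; fun_prop

theorem sa_cfc (f : ℝ → ℝ) (b : A) : star (cfc f b) = cfc f b :=
  (cfc_predicate f b : IsSelfAdjoint (cfc f b))

theorem cut_factor (b : A) (hb : star b = b) (γ δ : ℝ) (h : δ < γ) :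
    ∃ g : A, cfc (cutf γ) b = g * cfc (cutf δ) b := by
  have hb' : IsSelfAdjoint b := hb
  have hden : ∀ t, max (cutf δ t) (γ - δ) ≠ 0 := fun t =>
    (lt_of_lt_of_le (by linarith) (le_max_right _ _)).ne'
  have hc : Continuous (fun t => cutf γ t / max (cutf δ t) (γ - δ)) :=
    (cutf_cont γ).div ((cutf_cont δ).max continuous_const) hden
  refine ⟨cfc (fun t => cutf γ t / max (cutf δ t) (γ - δ)) b, ?_⟩
  rw [← cfc_mul _ _ b hc.continuousOn (cutf_cont δ).continuousOn]
  congr 1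
  ext t
  unfold cutf
  by_cases ht : |t| ≤ γ
  · rw [max_eq_right (by linarith : |t| - γ ≤ 0)]; simp
  · push Not at ht
    rw [max_eq_left (by linarith : 0 ≤ |t| - γ), max_eq_left (by linarith : 0 ≤ |t| - δ),
      max_eq_left (by linarith : γ - δ ≤ |t| - δ)]
    field_simp [show |t| - δ ≠ 0 by linarith]

theorem cut_norm (b : A) (hb : star b = b) (γ : ℝ) (hγ : 0 < γ) (s : A)
    (hs : cfc (cutf γ) b * s = 0) (hs1 : ‖s‖ ≤ 1) : ‖b * s‖ ≤ γ := by
  have hb' : IsSelfAdjoint b := hb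
  have hden : ∀ t : ℝ, max |t| γ ≠ 0 := fun t => (lt_of_lt_of_le hγ (le_max_right _ _)).ne'
  have hc1 : Continuous (fun t : ℝ => t / max |t| γ) :=
    continuous_id.div (by fun_prop) hden
  have hc2 : Continuous (fun t : ℝ => γ * (t / max |t| γ)) := continuous_const.mul hc1
  set k := fun t : ℝ => γ * (t / max |t| γ) with hk
  have hdec : b = cfc k b + cfc (fun t : ℝ => t / max |t| γ) b * cfc (cutf γ) b := by
    rw [← cfc_mul _ _ b hc1.continuousOn (cutf_cont γ).continuousOn,
      ← cfc_add b k (fun x => x / max |x| γ * cutf γ x) hc2.continuousOn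
        (hc1.mul (cutf_cont γ)).continuousOn]
    conv_lhs => rw [← cfc_id' ℝ b]
    congr 1
    ext t
    simp only [hk]
    unfold cutf
    by_cases ht : |t| ≤ γ
    · rw [max_eq_right (by linarith : |t| - γ ≤ 0), max_eq_right ht]
      field_simp
      ring
    · push Not at ht
      rw [max_eq_left (by linarith : 0 ≤ |t| - γ), max_eq_left ht.le]
      have : |t| ≠ 0 := by linarith
      field_simp
      ring
  have hbs : b * s = cfc k b * s := by
    conv_lhs => rw [hdec]
    rw [add_mul, mul_assoc, hs, mul_zero, add_zero]
  have hkn : ‖cfc k b‖ ≤ γ := by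
    refine norm_cfc_le hγ.le fun t _ => ?_
    simp only [hk, Real.norm_eq_abs]
    have hm : 0 < max |t| γ := lt_of_lt_of_le hγ (le_max_right _ _)
    rw [abs_mul, abs_div, abs_of_pos hm, abs_of_pos hγ]
    exact mul_le_of_le_one_right hγ.le ((div_le_one hm).mpr (le_max_left _ _))
  rw [hbs]
  calc _ ≤ ‖cfc k b‖ * ‖s‖ := norm_mul_le _ _
    _ ≤ γ * 1 := mul_le_mul hkn hs1 (norm_nonneg _) hγ.le
    _ = γ := mul_one _

theorem diag_small (π : A →⋆ₐ[ℂ] (H →L[ℂ] H)) (hπ : ∀ x, ‖π x‖ = ‖x‖)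
    (hN : ∀ y : A, star y = y → ∃ N, IsNullProj π y N)
    (T : A →ₗ[ℂ] A) (hT1 : T 1 = 0)
    (hK : ∀ c x : A, x * c = 0 → star c * x = 0 → star c * T x * c = 0)
    (b : A) (hb : star b = b) (ε : ℝ) (hε : 0 < ε) :
    ∃ γ > 0, ∀ s, IsNullProj π (cfc (cutf γ) b) s →
      ‖(T (b * b) - b * T b - T b * b) * s‖ ≤ ε := by
  have hb' : IsSelfAdjoint b := hb
  obtain ⟨e, he⟩ := hN b hb
  have heb : e * b = 0 := by
    have := congrArg star he.null
    rwa [star_mul, he.sa, hb, star_zero] at this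
  have hF : ∀ γ, ∃ s, IsNullProj π (cfc (cutf γ) b) s := fun γ => hN _ (sa_cfc _ _)
  choose s hs using hF
  have hbF : ∀ γ, b * cfc (cutf γ) b = cfc (cutf γ) b * b := fun γ => by
    have := cfc_commute_cfc (fun t : ℝ => t) (cutf γ) b
    rwa [cfc_id' ℝ b] at this
  have hbs : ∀ γ, b * s γ = s γ * b := fun γ => (hs γ).comm hb (hbF γ)
  have hes : ∀ γ, e * s γ = s γ * e := fun γ =>
    (he.comm (hs γ).sa (hbs γ).symm).symm
  have hs1 : ∀ γ, ‖s γ‖ ≤ 1 := fun γ => proj_norm_le_one (hs γ).sa (hs γ).idem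
  have hss : ∀ γ δ, 0 < δ → δ ≤ γ → s γ * s δ = s δ := by
    intro γ δ h0 h
    rcases h.eq_or_lt with h | h
    · rw [h]; exact (hs γ).idem
    · obtain ⟨g, hg⟩ := cut_factor b hb γ δ h
      exact (hs γ).univ _ (by rw [hg, mul_assoc, (hs δ).null, mul_zero])
  have hbn : ∀ γ, 0 < γ → ‖b * s γ‖ ≤ γ := fun γ h => cut_norm b hb γ h _ (hs γ).null (hs1 γ)
  have he1s : star (1 - e) = 1 - e := by rw [star_sub, he.sa, star_one]
  have he1i : (1 - e) * (1 - e) = 1 - e := by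
    rw [sub_mul, mul_sub, mul_sub, he.idem]; simp
  have he1n : ‖1 - e‖ ≤ 1 := proj_norm_le_one he1s he1i
  have hen : ‖e‖ ≤ 1 := proj_norm_le_one he.sa he.idem
  have hes1 : ∀ γ, (1 - e) * s γ = s γ * (1 - e) := fun γ => by
    rw [sub_mul, mul_sub, hes]; simp
  have hbbs : ∀ γ, 0 < γ → ‖b * b * s γ‖ ≤ ‖b‖ * γ := fun γ h => by
    rw [mul_assoc]
    exact (norm_mul_le _ _).trans (mul_le_mul_of_nonneg_left (hbn γ h) (norm_nonneg _))
  obtain ⟨γ₁, hγ₁, hump₁⟩ := hump π hπ T hK (b * b) (fun γ => s γ * (1 - e)) ‖b‖ (norm_nonneg _)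
    (fun γ _ => by rw [star_mul, he1s, (hs γ).sa, hes1])
    (fun γ δ h0 h => by
      show s γ * (1 - e) * (s δ * (1 - e)) = s δ * (1 - e)
      calc s γ * (1 - e) * (s δ * (1 - e)) = s γ * ((1 - e) * s δ) * (1 - e) := by noncomm_ring
        _ = (s γ * s δ) * ((1 - e) * (1 - e)) := by rw [hes1]; noncomm_ring
        _ = _ := by rw [hss γ δ h0 h, he1i])
    (fun γ _ => by
      have h1 : b * b * s γ = s γ * (b * b) := by
        rw [mul_assoc, hbs, ← mul_assoc, hbs, mul_assoc]
      have h2 : b * b * e = e * (b * b) := by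
        rw [mul_assoc, he.null, ← mul_assoc, heb]; simp
      show b * b * (s γ * (1 - e)) = s γ * (1 - e) * (b * b)
      have h3 : (b * b) * (1 - e) = (1 - e) * (b * b) := by rw [mul_sub, sub_mul, h2]; simp
      rw [← mul_assoc, h1, mul_assoc (s γ) (b * b) (1 - e), h3, mul_assoc (s γ) (1 - e)])
    (fun γ h => by
      show ‖b * b * (s γ * (1 - e))‖ ≤ ‖b‖ * γ
      rw [← mul_assoc]
      calc _ ≤ ‖b * b * s γ‖ * ‖1 - e‖ := norm_mul_le _ _
        _ ≤ (‖b‖ * γ) * 1 :=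
          mul_le_mul (hbbs γ h) he1n (norm_nonneg _) (by positivity)
        _ = _ := mul_one _)
    (fun ξ ε hε => by
      obtain ⟨η, hη⟩ := he.dens ξ (ε / 2) (by positivity)
      refine ⟨ε / (2 * (‖η‖ + 1)), by positivity, fun γ h0 h => ?_⟩
      have e1 : π (s γ * (1 - e)) ξ = π (s γ) (π (1 - e) ξ - π b η) + π (b * s γ) η := by
        rw [hbs, map_mul, map_mul, map_sub]; simp
      rw [e1]
      have n1 : ‖π (s γ) (π (1 - e) ξ - π b η)‖ ≤ ε / 2 := by
        refine ((π (s γ)).le_opNorm _).trans ?_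
        rw [hπ]
        calc _ ≤ 1 * (ε / 2) := mul_le_mul (hs1 γ) hη.le (norm_nonneg _) zero_le_one
          _ = _ := one_mul _
      have n2 : ‖π (b * s γ) η‖ ≤ ε / 2 := by
        refine ((π (b * s γ)).le_opNorm _).trans ?_
        rw [hπ]
        calc _ ≤ (ε / (2 * (‖η‖ + 1))) * ‖η‖ :=
              mul_le_mul_of_nonneg_right ((hbn γ h0).trans h) (norm_nonneg _)
          _ ≤ ε / 2 := by
            rw [div_mul_eq_mul_div, div_le_div_iff₀ (by positivity) (by positivity)]
            nlinarith [norm_nonneg η]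
      calc _ ≤ _ := norm_add_le _ _
        _ ≤ ε := by linarith)
    (ε / 2) (by positivity)
  set K := 2 * ‖T b‖ + 2 * (‖T (1 - e)‖ * ‖b‖) with hKd
  have hK0 : 0 ≤ K := by positivity
  set γ := min γ₁ (ε / (2 * (K + 1))) with hγ
  have hγ0 : 0 < γ := by positivity
  refine ⟨γ, hγ0, fun s' hs' => ?_⟩
  have hs's : s' = s γ := by
    have h1 : s γ * s' = s' := (hs γ).univ _ hs'.null
    have h2 : s' * s γ = s γ := hs'.univ _ (hs γ).null
    have h3 := congrArg star h1
    rw [star_mul, hs'.sa, (hs γ).sa, h2] at h3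
    exact h3.symm
  rw [hs's]
  have hcomm := defect_commute T hT1 hK (s γ) (hs γ).sa (hs γ).idem b (hbs γ).symm
  set D := T (b * b) - b * T b - T b * b with hD
  have hDs : D * s γ = s γ * D * s γ := by
    rw [hcomm, mul_assoc, (hs γ).idem]
  -- off-diagonal parts
  have hbb1 : (1 - e) * (b * b) = b * b := by rw [sub_mul, ← mul_assoc e, heb]; simp
  have hbb2 : b * b * (1 - e) = b * b := by rw [mul_sub, mul_assoc b b e, he.null]; simp
  obtain ⟨o1, o2⟩ := offdiag T hK (1 - e) he1s he1i (b * b) hbb1 hbb2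
  rw [sub_sub_cancel] at o1 o2
  have o3 : e * T (b * b) * e = 0 := by
    have := hK e (b * b) (by rw [mul_assoc, he.null, mul_zero])
      (by rw [he.sa, ← mul_assoc, heb, zero_mul])
    rwa [he.sa] at this
  have dec : s γ * D * s γ = s γ * (1 - e) * T (b * b) * (s γ * (1 - e))
      + s γ * (e * T (1 - e)) * (b * b * s γ) + (b * b * s γ) * (T (1 - e) * e) * s γ
      - (b * s γ) * T b * s γ - s γ * T b * (b * s γ) := by
    have d1 : T (b * b) = (1 - e) * T (b * b) * (1 - e) + e * T (1 - e) * (b * b)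
        + (b * b) * T (1 - e) * e := by
      rw [← o1, ← o2]
      have : T (b * b) = (1 - e) * T (b * b) * (1 - e) + e * T (b * b) * (1 - e)
        + (1 - e) * T (b * b) * e + e * T (b * b) * e := by noncomm_ring
      conv_lhs => rw [this, o3, add_zero]
    have d2 : b * b * s γ = s γ * (b * b) := by
      rw [mul_assoc, hbs, ← mul_assoc, hbs, mul_assoc]
    rw [hD, mul_sub, mul_sub, sub_mul, sub_mul]
    have c1 : s γ * T (b * b) * s γ = s γ * (1 - e) * T (b * b) * (s γ * (1 - e))
      + s γ * (e * T (1 - e)) * (b * b * s γ) + (b * b * s γ) * (T (1 - e) * e) * s γ := by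
      conv_lhs => rw [d1]
      have h0 : s γ * (1 - e) * T (b * b) * (s γ * (1 - e))
        = s γ * (1 - e) * T (b * b) * ((1 - e) * s γ) := by rw [hes1]
      rw [h0]
      generalize T (b * b) = X
      generalize T (1 - e) = Y
      have : (b * b * s γ) * (Y * e) * s γ = (s γ * (b * b)) * (Y * e) * s γ := by rw [d2]
      rw [this]
      noncomm_ring
    rw [c1]
    have c2 : s γ * (b * T b) * s γ = (b * s γ) * T b * s γ := by rw [hbs]; noncomm_ring
    have c3 : s γ * (T b * b) * s γ = s γ * T b * (b * s γ) := by noncomm_ring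
    rw [c2, c3]
  have hγ1 : γ ≤ γ₁ := min_le_left _ _
  have hγ2 : γ ≤ ε / (2 * (K + 1)) := min_le_right _ _
  have m1 := hump₁ γ hγ0 hγ1
  have nm : ∀ x y z : A, ‖x * y * z‖ ≤ ‖x‖ * ‖y‖ * ‖z‖ := fun x y z =>
    (norm_mul_le _ _).trans (mul_le_mul_of_nonneg_right (norm_mul_le _ _) (norm_nonneg _))
  have q1 : ‖e * T (1 - e)‖ ≤ ‖T (1 - e)‖ := (norm_mul_le _ _).trans
    (mul_le_of_le_one_left (norm_nonneg _) hen)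
  have q2 : ‖T (1 - e) * e‖ ≤ ‖T (1 - e)‖ := (norm_mul_le _ _).trans
    (mul_le_of_le_one_right (norm_nonneg _) hen)
  have m2 : ‖s γ * (e * T (1 - e)) * (b * b * s γ)‖ ≤ 1 * ‖T (1 - e)‖ * (‖b‖ * γ) := by
    refine (nm _ _ _).trans ?_
    gcongr
    exacts [hs1 γ, hbbs γ hγ0]
  have m3 : ‖(b * b * s γ) * (T (1 - e) * e) * s γ‖ ≤ (‖b‖ * γ) * ‖T (1 - e)‖ * 1 := by
    refine (nm _ _ _).trans ?_
    gcongr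
    exacts [hbbs γ hγ0, hs1 γ]
  have m4 : ‖(b * s γ) * T b * s γ‖ ≤ γ * ‖T b‖ * 1 := by
    refine (nm _ _ _).trans ?_
    gcongr
    exacts [hbn γ hγ0, hs1 γ]
  have m5 : ‖s γ * T b * (b * s γ)‖ ≤ 1 * ‖T b‖ * γ := by
    refine (nm _ _ _).trans ?_
    gcongr
    exacts [hs1 γ, hbn γ hγ0]
  rw [hDs, dec]
  have tri : ∀ x y z u w : A, ‖x + y + z - u - w‖ ≤ ‖x‖ + ‖y‖ + ‖z‖ + ‖u‖ + ‖w‖ := by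
    intro x y z u w
    linarith [norm_sub_le (x + y + z - u) w, norm_sub_le (x + y + z) u, norm_add_le (x + y) z,
      norm_add_le x y]
  refine (tri _ _ _ _ _).trans ?_
  have hfinal : γ * K ≤ ε / 2 := by
    calc γ * K ≤ (ε / (2 * (K + 1))) * K := by gcongr
      _ ≤ ε / 2 := by
        rw [div_mul_eq_mul_div, div_le_div_iff₀ (by positivity) (by positivity)]
        nlinarith
  have : γ * K = 1 * ‖T (1 - e)‖ * (‖b‖ * γ) + (‖b‖ * γ) * ‖T (1 - e)‖ * 1
    + γ * ‖T b‖ * 1 + 1 * ‖T b‖ * γ := by rw [hKd]; ring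
  linarith

end Diag

section Defect

variable {H : Type*} [NormedAddCommGroup H] [InnerProductSpace ℂ H] [CompleteSpace H]
variable {A : Type*} [CStarAlgebra A]

/-- Pythagoras in a representation. -/
theorem rep_pyth (π : A →⋆ₐ[ℂ] (H →L[ℂ] H)) (r : A) (hrs : star r = r) (hrr : r * r = r)
    (ξ : H) : ‖ξ‖ ^ 2 = ‖π r ξ‖ ^ 2 + ‖π (1 - r) ξ‖ ^ 2 := by
  have h1 : ξ = π r ξ + π (1 - r) ξ := by simp
  have h2 : ⟪π r ξ, π (1 - r) ξ⟫_ℂ = 0 := by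
    have : π (1 - r) = ContinuousLinearMap.adjoint (π (1 - r)) := by
      rw [← ContinuousLinearMap.star_eq_adjoint, ← map_star, star_sub, star_one, hrs]
    rw [this, ContinuousLinearMap.adjoint_inner_right, ← mul_apply_eq_comp, ← map_mul,
      sub_mul, hrr]
    simp
  have h3 := norm_add_sq_eq_norm_sq_add_norm_sq_of_inner_eq_zero _ _ h2
  rw [← h1] at h3
  simpa [sq] using h3

theorem union_small (π : A →⋆ₐ[ℂ] (H →L[ℂ] H)) (hπ : ∀ x, ‖π x‖ = ‖x‖) (D n r r' : A)
    (ε : ℝ) (hε : 0 ≤ ε)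
    (hns : star n = n) (hnn : n * n = n)
    (hrs : star r = r) (hrr : r * r = r) (hDr : r * D = D * r)
    (h1 : ‖D * r‖ ≤ ε) (h2 : ‖D * r'‖ ≤ ε) (hr' : r' * ((1 - r) * n) = (1 - r) * n) :
    ‖D * n‖ ≤ ε := by
  rw [← hπ]
  refine ContinuousLinearMap.opNorm_le_bound _ hε fun ξ => ?_
  have e1 : π r (π (D * n) ξ) = π (D * r) (π r (π n ξ)) := by
    simp only [← mul_apply_eq_comp, ← map_mul]
    congr 2
    rw [← mul_assoc r, hDr]
    simp only [← mul_assoc]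
    rw [mul_assoc D r r, hrr]
  have e2 : π (1 - r) (π (D * n) ξ) = π (D * r') (π (1 - r) (π n ξ)) := by
    simp only [← mul_apply_eq_comp, ← map_mul]
    congr 2
    rw [mul_assoc D r', hr', ← mul_assoc, ← mul_assoc, sub_mul, hDr, mul_sub]
    simp
  have b1 := (π (D * r)).le_opNorm (π r (π n ξ))
  have b2 := (π (D * r')).le_opNorm (π (1 - r) (π n ξ))
  have b3 := (π n).le_opNorm ξ
  rw [hπ] at b1 b2 b3
  have p1 := rep_pyth π r hrs hrr (π (D * n) ξ)
  have p2 := rep_pyth π r hrs hrr (π n ξ)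
  rw [e1, e2] at p1
  have b1' : ‖π (D * r) (π r (π n ξ))‖ ≤ ε * ‖π r (π n ξ)‖ := b1.trans (by gcongr)
  have b2' : ‖π (D * r') (π (1 - r) (π n ξ))‖ ≤ ε * ‖π (1 - r) (π n ξ)‖ := b2.trans (by gcongr)
  have b3' : ‖π n ξ‖ ≤ ‖ξ‖ := b3.trans
    (mul_le_of_le_one_left (norm_nonneg _) (proj_norm_le_one hns hnn))
  refine abs_le_of_sq_le_sq' ?_ (by positivity) |>.2
  have c1 := pow_le_pow_left₀ (norm_nonneg _) b1' 2
  have c2 := pow_le_pow_left₀ (norm_nonneg _) b2' 2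
  have c3 := pow_le_pow_left₀ (norm_nonneg _) b3' 2
  have c4 := mul_le_mul_of_nonneg_left c3 (sq_nonneg ε)
  rw [p1]
  nlinarith

theorem defect_zero (π : A →⋆ₐ[ℂ] (H →L[ℂ] H)) (hπ : ∀ x, ‖π x‖ = ‖x‖)
    (hN : ∀ y : A, star y = y → ∃ N, IsNullProj π y N)
    (T : A →ₗ[ℂ] A) (hT1 : T 1 = 0)
    (hK : ∀ c x : A, x * c = 0 → star c * x = 0 → star c * T x * c = 0)
    (a : A) (ha : star a = a) : T (a * a) - a * T a - T a * a = 0 := by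
  have ha' : IsSelfAdjoint a := ha
  set D := T (a * a) - a * T a - T a * a with hD
  suffices h : ∀ ε > 0, ‖D‖ ≤ ε by
    rw [← norm_le_zero_iff]
    exact le_of_forall_pos_le_add fun ε hε => by simpa using h ε hε
  intro ε hε
  have key : ∃ f : ℝ → ℝ, Continuous f ∧ (∀ t ∈ spectrum ℝ a, f t = 0) ∧
      ∀ N, IsNullProj π (cfc f a) N → ‖D * N‖ ≤ ε := by
    have hcomp : IsCompact (spectrum ℝ a) := ContinuousFunctionalCalculus.isCompact_spectrum a
    refine hcomp.induction_on (p := fun S => ∃ f : ℝ → ℝ, Continuous f ∧ (∀ t ∈ S, f t = 0) ∧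
      ∀ N, IsNullProj π (cfc f a) N → ‖D * N‖ ≤ ε) ?_ ?_ ?_ ?_
    · refine ⟨fun _ => 1, continuous_const, by simp, fun N hNN => ?_⟩
      have := hNN.null
      rw [cfc_const_one ℝ a, one_mul] at this
      rw [this]; simpa using hε.le
    · rintro S S' hSS ⟨f, hf, h0, h⟩
      exact ⟨f, hf, fun t ht => h0 t (hSS ht), h⟩
    · rintro S S' ⟨f, hf, hf0, hfN⟩ ⟨g, hg, hg0, hgN⟩
      refine ⟨fun t => f t * g t, hf.mul hg, ?_, fun n hn => ?_⟩
      · rintro t (ht | ht)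
        · simp [hf0 t ht]
        · simp [hg0 t ht]
      obtain ⟨r, hr⟩ := hN (cfc f a) (sa_cfc f a)
      obtain ⟨r', hr'⟩ := hN (cfc g a) (sa_cfc g a)
      have haf : a * cfc f a = cfc f a * a := by
        have := cfc_commute_cfc (fun t : ℝ => t) f a
        rwa [cfc_id' ℝ a] at this
      have hgf : cfc g a * cfc f a = cfc f a * cfc g a := cfc_commute_cfc g f a
      have hra : a * r = r * a := hr.comm ha haf
      have hrg : cfc g a * r = r * cfc g a := hr.comm (sa_cfc g a) hgf
      have hnull := hn.null
      rw [cfc_mul f g a hf.continuousOn hg.continuousOn, mul_assoc] at hnull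
      have h1 := hr.univ _ hnull
      refine union_small π hπ D n r r' ε hε.le hn.sa hn.idem hr.sa hr.idem
        (defect_commute T hT1 hK r hr.sa hr.idem a hra.symm) (hfN r hr) (hgN r' hr') ?_
      apply hr'.univ
      rw [← mul_assoc, mul_sub, hrg, mul_one, sub_mul, mul_assoc r, h1, sub_self]
    · intro c _
      set b := a - algebraMap ℝ A c with hbdef
      have hb : star b = b := by
        rw [hbdef, star_sub, ha]
        congr 1
        exact IsSelfAdjoint.algebraMap A (.all c)
      obtain ⟨γ, hγ, hs⟩ := diag_small π hπ hN T hT1 hK b hb ε hε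
      have hbD : T (b * b) - b * T b - T b * b = D := by
        have hc : algebraMap ℝ A c = (c : ℂ) • (1 : A) := by
          rw [Algebra.algebraMap_eq_smul_one]; simp
        rw [hbdef, hD, hc]
        simp only [sub_mul, mul_sub, map_sub, map_smul, hT1, smul_mul_assoc, mul_smul_comm,
          one_mul, mul_one, smul_zero, sub_zero]
        abel
      have hcfc : cfc (cutf γ) b = cfc (fun t => cutf γ (t - c)) a := by
        have h1 : b = cfc (fun t : ℝ => t - c) a := by
          rw [cfc_sub (fun t => t) (fun _ => c) a, cfc_id' ℝ a, cfc_const c a]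
        rw [h1, ← cfc_comp' (cutf γ) (fun t => t - c) a (cutf_cont γ).continuousOn]
      refine ⟨{t | |t - c| < γ}, ?_, fun t => cutf γ (t - c),
        (cutf_cont γ).comp (by fun_prop), ?_, ?_⟩
      · apply mem_nhdsWithin_of_mem_nhds
        have : {t : ℝ | |t - c| < γ} = Metric.ball c γ := by
          ext t; simp [Real.dist_eq]
        rw [this]; exact Metric.ball_mem_nhds c hγ
      · intro t ht
        have ht' : |t - c| < γ := ht
        unfold cutf
        exact max_eq_right (by linarith)
      · intro N hNN
        rw [← hcfc] at hNN
        rw [← hbD]; exact hs N hNN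
  obtain ⟨f, hf, h0, hfN⟩ := key
  have hz : cfc f a = 0 := by
    rw [cfc_congr (g := fun _ => (0 : ℝ)) (fun t ht => h0 t ht)]
    simp
  obtain ⟨N, hNN⟩ := hN (cfc f a) (sa_cfc f a)
  have hN1 : N = 1 := by simpa using hNN.univ 1 (by rw [hz, zero_mul])
  have := hfN N hNN
  rwa [hN1, mul_one] at this

theorem abstract_main (π : A →⋆ₐ[ℂ] (H →L[ℂ] H)) (hπ : ∀ x, ‖π x‖ = ‖x‖)
    (hN : ∀ y : A, star y = y → ∃ N, IsNullProj π y N)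
    (T : A →ₗ[ℂ] A) (hT1 : T 1 = 0)
    (hK : ∀ c x : A, x * c = 0 → star c * x = 0 → star c * T x * c = 0) :
    ∀ x y, T (x * y) = T x * y + x * T y := by
  have hd : ∀ a : A, star a = a → T (a * a) = a * T a + T a * a := fun a ha => by
    have := defect_zero π hπ hN T hT1 hK a ha
    rw [sub_sub, sub_eq_zero] at this
    exact this
  have hsa : ∀ a b : A, star a = a → star b = b →
      T (a * b + b * a) = T a * b + a * T b + T b * a + b * T a := by
    intro a b ha hb
    have h1 := hd a ha
    have h2 := hd b hb
    have h3 := hd (a + b) (by rw [star_add, ha, hb])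
    have e : (a + b) * (a + b) = a * a + (a * b + b * a) + b * b := by noncomm_ring
    rw [e, map_add, map_add, map_add T a b, h1, h2] at h3
    have h4 : T (a * b + b * a) =
      ((a + b) * (T a + T b) + (T a + T b) * (a + b)) - (a * T a + T a * a) - (b * T b + T b * b) := by
      rw [← h3]; abel
    rw [h4]; noncomm_ring
  have hdec : ∀ x : A, ∃ h k : A, star h = h ∧ star k = k ∧ x = h + Complex.I • k := fun x =>
    ⟨realPart x, imaginaryPart x, (realPart x).2, (imaginaryPart x).2,
      (realPart_add_I_smul_imaginaryPart x).symm⟩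
  refine jordan_is_derivation ?_ T (fun x y => map_add T x y) ?_
  · intro u hu
    have h := hu (star u)
    have h1 : star (star u * u) * (star u * u) = 0 := by
      rw [star_mul, star_star, mul_assoc, ← mul_assoc u, h, mul_zero]
    exact CStarRing.star_mul_self_eq_zero_iff _ |>.1 (CStarRing.star_mul_self_eq_zero_iff _ |>.1 h1)
  · intro x y
    obtain ⟨h, k, hh, hk, rfl⟩ := hdec x
    obtain ⟨p, q, hp, hq, rfl⟩ := hdec y
    have e1 := hsa h p hh hp
    have e2 := hsa h q hh hq
    have e3 := hsa k p hk hp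
    have e4 := hsa k q hk hq
    have e : (h + Complex.I • k) * (p + Complex.I • q) + (p + Complex.I • q) * (h + Complex.I • k)
      = (h * p + p * h) + Complex.I • (h * q + q * h) + Complex.I • (k * p + p * k)
        + Complex.I • Complex.I • (k * q + q * k) := by
      simp only [add_mul, mul_add, smul_mul_assoc, mul_smul_comm, smul_add]
      abel
    rw [e]
    simp only [map_add T _ (Complex.I • _), map_smul]
    rw [e1, e2, e3, e4]
    simp only [add_mul, mul_add, smul_mul_assoc, mul_smul_comm, smul_add]
    abel

end Defect

section Concrete

theorem vna_isClosed (M : VonNeumannAlgebra H) : IsClosed (M : Set (H →L[ℂ] H)) := by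
  rw [← M.centralizer_centralizer]
  exact Set.isClosed_centralizer _

theorem ker_starProjection_mem (M : VonNeumannAlgebra H) (y : H →L[ℂ] H) (hy : y ∈ M) :
    (y.ker).starProjection ∈ M := by
  rw [VonNeumannAlgebra.IsStarProjection.mem_iff isStarProjection_starProjection]
  intro z hz
  rw [Submodule.range_starProjection, Module.End.mem_invtSubmodule]
  intro ξ hξ
  have h := VonNeumannAlgebra.mem_commutant_iff.1 hz y hy
  have h2 := congrArg (fun w : H →L[ℂ] H => w ξ) h
  have hξ' : y ξ = 0 := hξ
  simp only [mul_apply_eq_comp, hξ', map_zero] at h2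
  exact h2

/-- The inclusion of a von Neumann algebra as a star homomorphism. -/
def inclHom (M : VonNeumannAlgebra H) : ↥M →⋆ₐ[ℂ] (H →L[ℂ] H) where
  toFun x := x
  map_one' := rfl
  map_mul' _ _ := rfl
  map_zero' := rfl
  map_add' _ _ := rfl
  commutes' _ := rfl
  map_star' _ := rfl

theorem vector_test (M : VonNeumannAlgebra H) (T : ↥M → ↥M)
    (hT : IsWeakStarLocalDerivation M T) (x : ↥M) (η : H)
    (h : ∀ D : ↥M → ↥M, IsDerivationOn M D → ⟪η, (D x : H →L[ℂ] H) η⟫_ℂ = 0) :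
    ⟪η, (T x : H →L[ℂ] H) η⟫_ℂ = 0 := by
  rcases eq_or_ne η 0 with h0 | h0
  · simp [h0]
  have hn : (‖η‖ : ℂ) ≠ 0 := by simpa using h0
  set ζ : H := (‖η‖ : ℂ)⁻¹ • η with hζ
  have hζn : ‖ζ‖ = 1 := by
    rw [hζ, norm_smul]; simp [h0]
  have hφ : ∀ z : H →L[ℂ] H, ⟪ζ, z ζ⟫_ℂ = (‖η‖ : ℂ)⁻¹ * (‖η‖ : ℂ)⁻¹ * ⟪η, z η⟫_ℂ := by
    intro z
    rw [hζ, map_smul, inner_smul_left, inner_smul_right]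
    simp [mul_assoc]
  obtain ⟨D, hD, hDe⟩ := hT.2 x (fun z => ⟪ζ, z ζ⟫_ℂ)
    ⟨fun n => if n = 0 then ζ else 0, by
      rw [tsum_eq_single 0 (fun n hn => by simp [hn])]; simp [hζn], fun z => by
      rw [tsum_eq_single 0 (fun n hn => by simp [hn])]; simp⟩
  simp only [hφ, h D hD, mul_zero] at hDe
  simpa [hn] using hDe

theorem concrete_null (M : VonNeumannAlgebra H) (y : ↥M) (hy : star y = y) :
    ∃ N : ↥M, (star N = N ∧ N * N = N ∧ y * N = 0 ∧ (∀ z, y * z = 0 → N * z = z)) ∧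
      ∀ (ξ : H) (ε : ℝ), 0 < ε → ∃ η : H,
        ‖inclHom M (1 - N) ξ - inclHom M y η‖ < ε := by
  have hsp := isStarProjection_starProjection (U := (y : H →L[ℂ] H).ker)
  refine ⟨⟨_, ker_starProjection_mem M y y.2⟩, ⟨?_, ?_, ?_, ?_⟩, ?_⟩
  · exact Subtype.ext hsp.isSelfAdjoint
  · exact Subtype.ext hsp.isIdempotentElem
  · apply Subtype.ext
    ext ξ
    exact Submodule.starProjection_apply_mem (y : H →L[ℂ] H).ker ξ
  · intro z hz
    apply Subtype.ext
    ext ξ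
    have h2 : (y : H →L[ℂ] H) ((z : H →L[ℂ] H) ξ) = 0 :=
      congrArg (fun w : ↥M => (w : H →L[ℂ] H) ξ) hz
    exact Submodule.starProjection_eq_self_iff.2 h2
  · intro ξ ε hε
    have hadj : ContinuousLinearMap.adjoint (y : H →L[ℂ] H) = y := congrArg Subtype.val hy
    have hmem : ξ - ((y : H →L[ℂ] H).ker).starProjection ξ ∈ ((y : H →L[ℂ] H).ker)ᗮ :=
      Submodule.sub_starProjection_mem_orthogonal ξ
    rw [ContinuousLinearMap.orthogonal_ker, hadj] at hmem
    have hmem' : ξ - ((y : H →L[ℂ] H).ker).starProjection ξ ∈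
      closure ((y : H →L[ℂ] H).range : Set H) := hmem
    obtain ⟨_, ⟨η, rfl⟩, hη⟩ := Metric.mem_closure_iff.1 hmem' ε hε
    rw [dist_eq_norm] at hη
    exact ⟨η, hη⟩

end Concrete

/-- Every weak*-local derivation on a von Neumann algebra is a derivation. -/
theorem weakStarLocalDerivation_is_derivation (M : VonNeumannAlgebra H) (T : ↥M → ↥M)
    (hT : IsWeakStarLocalDerivation M T) : ∀ a b : ↥M, T (a * b) = T a * b + a * T b := by
  haveI : IsClosed (M : Set (H →L[ℂ] H)) := vna_isClosed M
  have hzero : ∀ z : ↥M, (∀ ξ : H, ⟪ξ, (z : H →L[ℂ] H) ξ⟫_ℂ = 0) → z = 0 := by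
    intro z hz
    apply Subtype.ext
    apply ContinuousLinearMap.coe_injective
    refine (inner_map_self_eq_zero (z : H →L[ℂ] H).toLinearMap).1 fun ξ => ?_
    rw [← inner_conj_symm]
    simp [hz ξ]
  have hT1 : T 1 = 0 := by
    refine hzero _ fun ξ => vector_test M T hT 1 ξ fun D hD => ?_
    have h := hD.2 1 1
    rw [mul_one, mul_one, one_mul] at h
    rw [left_eq_add.1 h]
    simp
  have hK : ∀ c x : ↥M, x * c = 0 → star c * x = 0 → star c * T x * c = 0 := by
    intro c x hxc hcx
    have hin : ∀ (w : ↥M) (ξ : H), ⟪ξ, ((star c * w * c : ↥M) : H →L[ℂ] H) ξ⟫_ℂ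
        = ⟪(c : H →L[ℂ] H) ξ, (w : H →L[ℂ] H) ((c : H →L[ℂ] H) ξ)⟫_ℂ := fun w ξ =>
      ContinuousLinearMap.adjoint_inner_right (c : H →L[ℂ] H) ξ _
    refine hzero _ fun ξ => ?_
    rw [hin]
    refine vector_test M T hT x _ fun D hD => ?_
    rw [← hin]
    have h1 := hD.2 (star c) x
    rw [hcx, hD.1.map_zero] at h1
    have h2 : star c * D x * c = 0 := by
      have h3 := congrArg (· * c) h1
      simp only [zero_mul, add_mul] at h3
      rw [mul_assoc (D (star c)), hxc, mul_zero, zero_add] at h3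
      exact h3.symm
    rw [h2]; simp
  have main := abstract_main (A := ↥M) (inclHom M) (fun _ => rfl)
    (fun y hy => by
      obtain ⟨N, ⟨h1, h2, h3, h4⟩, h5⟩ := concrete_null M y hy
      exact ⟨N, h1, h2, h3, h4, h5⟩)
    (hT.1.mk' T) hT1 hK
  exact main
end

section
/- If T : M → M is a bounded linear operator on a von Neumann algebra satisfying T(p) = pT(p)(1−p) + (1−p)T(p)p for every projection p ∈ M, then T is a derivation. -/
open scoped ComplexOrder InnerProductSpace

variable {H : Type*} [NormedAddCommGroup H] [InnerProductSpace ℂ H] [CompleteSpace H]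

section Jordan
variable {R : Type*} [Ring R]

theorem jd_semiprime_aux (h2 : ∀ a : R, a + a = 0 → a = 0)
    (hs : ∀ a : R, (∀ x, a * x * a = 0) → a = 0) (u v : R)
    (h : ∀ x, u * x * v + v * x * u = 0) (x : R) : u * x * v = 0 := by
  apply hs
  intro y
  apply h2
  have e1 := h x
  have e2 := h y
  have e3 := h (x * u * y)
  linear_combination (norm := noncomm_ring) u * x * e2 * x * v - e3 * x * v
    + v * x * u * y * e1 + e1 * y * (u * x * v) - v * x * u * y * e1

theorem jd_is_derivation (h2 : ∀ a : R, a + a = 0 → a = 0)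
    (hs : ∀ a : R, (∀ x, a * x * a = 0) → a = 0) (d : R →+ R)
    (hd : ∀ a, d (a * a) = d a * a + a * d a) (a b : R) :
    d (a * b) = d a * b + a * d b := by
  have j1 : ∀ a b, d (a * b) + d (b * a) = d a * b + a * d b + d b * a + b * d a := by
    intro a b
    have := hd (a + b)
    simp only [mul_add, add_mul, map_add] at this
    linear_combination (norm := noncomm_ring) this - hd a - hd b
  have j2 : ∀ a b, d (a * b * a) = d a * b * a + a * d b * a + a * b * d a := by
    intro a b
    rw [← sub_eq_zero]
    apply h2
    have e1 := j1 a (a * b + b * a)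
    have e2 := j1 (a * a) b
    have e3 := j1 a b
    simp only [mul_add, add_mul, map_add, hd, ← mul_assoc] at e1 e2
    linear_combination (norm := noncomm_ring) e1 - e2 + a * e3 + e3 * a
  have j3 : ∀ a b c, d (a * b * c) + d (c * b * a) = d a * b * c + a * d b * c + a * b * d c
      + d c * b * a + c * d b * a + c * b * d a := by
    intro a b c
    have := j2 (a + c) b
    simp only [mul_add, add_mul, map_add] at this
    linear_combination (norm := noncomm_ring) this - j2 a b - j2 c b
  let δ : R → R → R := fun a b => d (a * b) - d a * b - a * d b
  have hδ : ∀ a b, δ a b = d (a * b) - d a * b - a * d b := fun _ _ => rfl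
  have j4 : ∀ a b x, δ a b * x * (a * b - b * a) + (a * b - b * a) * x * δ a b = 0 := by
    intro a b x
    have e1 := j3 (a * b) x (b * a)
    have e2 := j2 a (b * x * b)
    have e3 := j2 b (a * x * a)
    have e4 := j2 b x
    have e5 := j2 a x
    have e6 := j1 a b
    rw [e4] at e2
    rw [e5] at e3
    simp only [← mul_assoc] at e1 e2 e3
    have e7 : d (b * a) = d a * b + a * d b + d b * a + b * d a - d (a * b) := by
      rw [← e6]; noncomm_ring
    rw [e7] at e1
    rw [hδ]
    linear_combination (norm := noncomm_ring) e1 - e2 - e3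
  have j5 : ∀ a b x, δ a b * x * (a * b - b * a) = 0 := fun a b x =>
    jd_semiprime_aux h2 hs _ _ (j4 a b) x
  have δl : ∀ a c b, δ (a + c) b = δ a b + δ c b := by
    intro a c b; simp only [hδ, add_mul, map_add]; noncomm_ring
  have δr : ∀ a b c, δ a (b + c) = δ a b + δ a c := by
    intro a c b; simp only [hδ, mul_add, map_add]; noncomm_ring
  have j6 : ∀ a b c x, δ a b * x * (c * b - b * c) = 0 := by
    intro a b c x
    apply hs
    intro y
    have e := j5 (a + c) b x
    rw [δl] at e
    have e1 := j5 a b (x * (c * b - b * c) * y * δ c b * x)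
    linear_combination (norm := noncomm_ring)
      δ a b * x * (c * b - b * c) * y * e - e1
       - δ a b * x * (c * b - b * c) * y * j5 a b x - δ a b * x * (c * b - b * c) * y * j5 c b x
  have j7 : ∀ a b c e x, δ a b * x * (c * e - e * c) = 0 := by
    intro a b c f x
    apply hs
    intro y
    have e := j6 a (b + f) c x
    rw [δr] at e
    have e1 := j6 a b c (x * (c * f - f * c) * y * δ a f * x)
    linear_combination (norm := noncomm_ring)
      δ a b * x * (c * f - f * c) * y * e - e1
       - δ a b * x * (c * f - f * c) * y * j6 a b c x - δ a b * x * (c * f - f * c) * y * j6 a f c x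
  have hu : ∀ c e x, δ a b * x * (c * e - e * c) = 0 := j7 a b
  have hu' : δ a b = d (a * b) - d a * b - a * d b := hδ a b
  suffices hz : δ a b = 0 by
    rw [hz] at hu'
    linear_combination (norm := noncomm_ring) -hu'
  generalize δ a b = u at hu hu'
  have hc : ∀ y, u * y = y * u := by
    intro y
    rw [← sub_eq_zero]
    apply hs
    intro x
    have e1 := hu u y (y * x)
    have e2 := hu u y x
    linear_combination (norm := noncomm_ring) e1 - y * e2
  obtain ⟨w, hw⟩ : ∃ w, w = a * b - b * a := ⟨_, rfl⟩
  have hdw : d w = d (a * b) - d (b * a) := by rw [hw, map_sub]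
  have huw : ∀ x, u * x * w = 0 := by rw [hw]; exact hu a b
  have k1 : u * d w = u * u + u * u := by
    have e1 := hu (d a) b 1
    have e2 := hu a (d b) 1
    rw [hdw]
    linear_combination (norm := noncomm_ring) e1 + e2 - u * j1 a b - 2 * u * hu'
  have k0 : u * w = 0 := by simpa using huw 1
  have k0' : w * u = 0 := by rw [← hc]; exact k0
  have k2 : d u * w + u * d w + d w * u + w * d u = 0 := by
    rw [← j1, k0, k0']; simp
  have k3 : u * u * d w = 0 := by
    apply h2
    have e1 := huw (d u)
    linear_combination (norm := noncomm_ring) u * k2 - e1 - k0 * d u + u * hc (d w)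
  have k4 : u * u * u = 0 := by
    apply h2
    linear_combination (norm := noncomm_ring) k3 - u * k1
  have k5 : u * u = 0 := by
    apply hs
    intro x
    linear_combination (norm := noncomm_ring) -u * u * hc x * u - u * u * u * hc x + k4 * u * x
  apply hs
  intro x
  linear_combination (norm := noncomm_ring) -u * hc x + k5 * x

end Jordan
section Spectral

open ContinuousLinearMap

/-- One step of the dyadic expansion of a positive operator. -/
theorem exists_proj_step {x : H →L[ℂ] H} {c : ℝ} (hc : 0 ≤ c) (hx0 : 0 ≤ x)
    (hxc : x ≤ algebraMap ℝ (H →L[ℂ] H) c) :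
    ∃ p : H →L[ℂ] H, star p = p ∧ p * p = p ∧ (∀ y, Commute x y → Commute p y) ∧
      0 ≤ x - (c / 2) • p ∧ x - (c / 2) • p ≤ algebraMap ℝ (H →L[ℂ] H) (c / 2) := by
  have hxs : IsSelfAdjoint x := IsSelfAdjoint.of_nonneg hx0
  set b : H →L[ℂ] H := x - algebraMap ℝ _ (c / 2) with hb
  have hbs : IsSelfAdjoint b := hxs.sub (IsSelfAdjoint.algebraMap _ (IsSelfAdjoint.all _))
  have hbpn : b⁺ - b⁻ = b := CFC.posPart_sub_negPart b hbs
  have hmul : b⁺ * b⁻ = 0 := CFC.posPart_mul_negPart b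
  have hp0 : 0 ≤ b⁺ := CFC.posPart_nonneg b
  have hn0 : 0 ≤ b⁻ := CFC.negPart_nonneg b
  let K : Submodule ℂ H := (b⁺ : H →L[ℂ] H).ker
  have hKc : IsClosed (K : Set H) := (b⁺ : H →L[ℂ] H).isClosed_ker
  have : CompleteSpace K := hKc.completeSpace_coe
  let q : H →L[ℂ] H := K.starProjection
  have hq : IsStarProjection q := isStarProjection_starProjection
  have hqs : star q = q := hq.isSelfAdjoint
  have hqq : q * q = q := hq.isIdempotentElem
  have hq1 : ∀ z : H →L[ℂ] H, b⁺ * z = 0 → q * z = z := by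
    intro z hz
    ext v
    have : z v ∈ K := by
      have := congrArg (fun f : H →L[ℂ] H => f v) hz
      simpa [K] using this
    exact K.starProjection_eq_self_iff.2 this
  have hq2 : b⁺ * q = 0 := by
    ext v
    have : q v ∈ K := K.starProjection_apply_mem v
    simpa [K] using this
  have hcomm : ∀ y, Commute x y → Commute q y := by
    have key : ∀ y, Commute x y → q * (y * q) = y * q := by
      intro y hy
      apply hq1
      have h1 : Commute b y := hy.sub_left (Algebra.commutes _ _)
      have h2 : Commute b⁺ y := by
        rw [CFC.posPart_def]
        exact h1.cfcₙ_real _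
      rw [← mul_assoc, h2.eq, mul_assoc, hq2, mul_zero]
    intro y hy
    have hy' : Commute x (star y) := by
      have := hy.star_star
      rwa [hxs.star_eq] at this
    have h1 := key y hy
    have h2 := congrArg star (key _ hy')
    simp only [star_mul, star_star, hqs] at h2
    change q * y = y * q
    rw [← h1, ← mul_assoc, h2]
  have hxq : Commute q x := hcomm x (Commute.refl x)
  have hn : q * b⁻ = b⁻ := hq1 _ hmul
  have hqb : q * b⁺ = 0 := by
    have := congrArg star hq2
    simpa [hqs, (IsSelfAdjoint.of_nonneg hp0).star_eq] using this
  have hbx : x = b⁺ - b⁻ + (c/2) • (1 : H →L[ℂ] H) := by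
    rw [hbpn, hb, Algebra.algebraMap_eq_smul_one]; abel
  have hpb : (1 - q) * x * (1 - q) = (1 - q) * x := by
    rw [mul_assoc, mul_sub, mul_one, ← hxq.eq, mul_sub, ← mul_assoc _ q x, sub_mul 1 q q, hqq]
    simp
  have e0 : q * x = (c/2) • q - b⁻ := by
    conv_lhs => rw [hbx]
    rw [mul_add, mul_sub, hqb, hn, mul_smul_comm, mul_one]; abel
  have hqxq : q * x * q = q * x := by rw [mul_assoc, ← hxq.eq, ← mul_assoc, hqq]
  refine ⟨1 - q, by simp [hqs], by simp [mul_sub, sub_mul, hqq],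
    fun y hy => (Commute.one_left y).sub_left (hcomm y hy), ?_, ?_⟩
  · have e : x - (c/2) • (1 - q) = b⁺ + q * x * q := by
      rw [hqxq, e0]
      conv_lhs => rw [hbx]
      rw [smul_sub]; abel
    rw [e]
    exact add_nonneg hp0 ((show IsSelfAdjoint q from hqs).conjugate_nonneg hx0)
  · have hcx : 0 ≤ algebraMap ℝ (H →L[ℂ] H) c - x := sub_nonneg.2 hxc
    have hs1 : IsSelfAdjoint (1 - q) := by simp [IsSelfAdjoint, hqs]
    have h3 := hs1.conjugate_nonneg hcx
    rw [← sub_nonneg]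
    have e : algebraMap ℝ (H →L[ℂ] H) (c/2) - (x - (c/2) • (1 - q))
        = b⁻ + (1 - q) * (algebraMap ℝ (H →L[ℂ] H) c - x) * (1 - q) := by
      have h4 : (1 - q) * (1 - q) = 1 - q := by simp [mul_sub, sub_mul, hqq]
      rw [mul_sub (1 - q) _ x, sub_mul _ _ (1 - q), hpb, Algebra.algebraMap_eq_smul_one, Algebra.algebraMap_eq_smul_one,
        mul_smul_comm, mul_one, smul_mul_assoc, h4, sub_mul 1 q x, one_mul, e0]
      have : c • (1 - q) = (c/2) • (1 - q) + (c/2) • (1 - q) := by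
        rw [← add_smul]; congr 1; ring
      rw [this]
      simp only [smul_sub]
      abel
    rw [e]
    exact add_nonneg hn0 h3

/-- Projections in the bicommutant of `a`. -/
def bicommProj (a : H →L[ℂ] H) : Set (H →L[ℂ] H) :=
  {p | star p = p ∧ p * p = p ∧ ∀ y, Commute a y → Commute p y}

theorem exists_dyadic {a : H →L[ℂ] H} {c : ℝ} (hc : 0 ≤ c) (ha0 : 0 ≤ a)
    (hac : a ≤ algebraMap ℝ (H →L[ℂ] H) c) (n : ℕ) :
    ∃ s ∈ Submodule.span ℝ (bicommProj a), (∀ y, Commute a y → Commute s y) ∧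
      0 ≤ a - s ∧ a - s ≤ algebraMap ℝ (H →L[ℂ] H) (c / 2 ^ n) := by
  induction n with
  | zero => exact ⟨0, zero_mem _, fun y _ => Commute.zero_left y, by simpa using ha0, by simpa using hac⟩
  | succ n ih =>
    obtain ⟨s, hs, hsc, h0, h1⟩ := ih
    obtain ⟨p, hp1, hp2, hp3, hp4, hp5⟩ := exists_proj_step (by positivity) h0 h1
    have hpc : ∀ y, Commute a y → Commute p y := fun y hy => hp3 y (hy.sub_left (hsc y hy))
    refine ⟨s + (c / 2 ^ n / 2) • p, add_mem hs (Submodule.smul_mem _ _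
      (Submodule.subset_span ⟨hp1, hp2, hpc⟩)), fun y hy => (hsc y hy).add_left
        ((hpc y hy).smul_left _), ?_, ?_⟩
    · rwa [← sub_sub]
    · rw [← sub_sub, pow_succ, ← div_div]; exact hp5

theorem mem_closure_span_bicommProj {a : H →L[ℂ] H} (ha0 : 0 ≤ a) :
    a ∈ closure (Submodule.span ℝ (bicommProj a) : Set (H →L[ℂ] H)) := by
  rw [Metric.mem_closure_iff]
  intro ε hε
  have hac : a ≤ algebraMap ℝ (H →L[ℂ] H) ‖a‖ :=
    IsSelfAdjoint.le_algebraMap_norm_self (IsSelfAdjoint.of_nonneg ha0)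
  have ht : Filter.Tendsto (fun n : ℕ => ‖a‖ / 2 ^ n) Filter.atTop (nhds 0) :=
    tendsto_const_nhds.div_atTop (tendsto_pow_atTop_atTop_of_one_lt (by norm_num))
  obtain ⟨n, hn⟩ := (ht.eventually_lt_const hε).exists
  obtain ⟨s, hs, _, h0, h1⟩ := exists_dyadic (norm_nonneg a) ha0 hac n
  refine ⟨s, hs, ?_⟩
  rw [dist_eq_norm]
  exact lt_of_le_of_lt ((CStarAlgebra.norm_le_iff_le_algebraMap (a - s) (by positivity) h0).2 h1) hn

theorem bicommProj_subset (M : VonNeumannAlgebra H) {a : H →L[ℂ] H} (ha : a ∈ M) :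
    bicommProj a ⊆ M := by
  intro p hp
  rw [← VonNeumannAlgebra.centralizer_centralizer M]
  intro y hy
  exact (hp.2.2 y (hy a ha)).symm

end Spectral
set_option maxHeartbeats 2000000 in
/-- A bounded linear operator on a von Neumann algebra satisfying
`T p = p (T p) (1-p) + (1-p) (T p) p` for every projection `p` is a derivation. -/
theorem bounded_op_proj_rule_is_derivation (M : VonNeumannAlgebra H) (T : ↥M → ↥M)
    (hlin : IsLinearMap ℂ T) (hcont : Continuous T)
    (h : ∀ p : ↥M, star p = p → p * p = p → T p = p * T p * (1 - p) + (1 - p) * T p * p) :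
    ∀ a b : ↥M, T (a * b) = T a * b + a * T b := by
  have Tadd : ∀ x y, T (x + y) = T x + T y := hlin.map_add
  have Tsmul : ∀ (c : ℂ) x, T (c • x) = c • T x := hlin.map_smul
  have T0 : T 0 = 0 := hlin.map_zero
  have sm1 : ∀ (c : ℂ) (x y : M), (c • x) * y = c • (x * y) := fun c x y =>
    Subtype.ext (smul_mul_assoc c (x : H →L[ℂ] H) y)
  have sm2 : ∀ (c : ℂ) (x y : M), x * (c • y) = c • (x * y) := fun c x y =>
    Subtype.ext (mul_smul_comm c (x : H →L[ℂ] H) y)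
  have hJ : ∀ p : M, star p = p → p * p = p → T p = T p * p + p * T p := by
    intro p h1 h2
    have e := h p h1 h2
    have e1 : p * T p * p = 0 := by
      linear_combination (norm := noncomm_ring) p * e * p - p * p * T p * h2 - h2 * T p * p * p
    linear_combination (norm := noncomm_ring) e - 2 * e1
  -- the symmetrised defect
  let B : M → M → M := fun x y =>
    T (x * y) + T (y * x) - (T x * y + x * T y + T y * x + y * T x)
  have hB : ∀ x y, B x y = T (x * y) + T (y * x) - (T x * y + x * T y + T y * x + y * T x) :=
    fun _ _ => rfl
  have Bsymm : ∀ x y, B x y = B y x := by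
    intro x y; simp only [hB]; abel
  have Badd : ∀ x y z, B (x + y) z = B x z + B y z := by
    intro x y z; simp only [hB, add_mul, mul_add, Tadd]; abel
  have Badd' : ∀ x y z, B z (x + y) = B z x + B z y := by
    intro x y z; rw [Bsymm, Badd, Bsymm x, Bsymm y]
  have Bsmul : ∀ (c : ℂ) x y, B (c • x) y = c • B x y := by
    intro c x y
    simp only [hB, sm1, sm2, Tsmul, smul_add, smul_sub]
  have Bsmul' : ∀ (c : ℂ) x y, B y (c • x) = c • B y x := by
    intro c x y; rw [Bsymm, Bsmul, Bsymm x]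
  have Bpp : ∀ p : M, star p = p → p * p = p → B p p = 0 := by
    intro p h1 h2
    have e := hJ p h1 h2
    rw [hB, h2]
    linear_combination (norm := noncomm_ring) 2 * e
  have Bort : ∀ p q : M, star p = p → p * p = p → star q = q → q * q = q → p * q = 0 →
      q * p = 0 → B p q = 0 := by
    intro p q hp1 hp2 hq1 hq2 hpq hqp
    have e := Bpp (p + q) (by rw [star_add, hp1, hq1])
      (by rw [mul_add, add_mul, add_mul, hp2, hq2, hpq, hqp]; abel)
    rw [Badd, Badd', Badd', Bpp p hp1 hp2, Bpp q hq1 hq2, Bsymm q p, zero_add, add_zero,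
      ← two_smul ℂ] at e
    have e2 := congrArg (fun z => (2⁻¹ : ℂ) • z) e
    simpa [smul_smul] using e2
  have Bcomm : ∀ p q : M, star p = p → p * p = p → star q = q → q * q = q → p * q = q * p →
      B p q = 0 := by
    intro p q hp1 hp2 hq1 hq2 hpq
    obtain ⟨r, hr⟩ : ∃ r, r = p * q := ⟨_, rfl⟩
    have hrs : star r = r := by rw [hr, star_mul, hp1, hq1, hpq]
    have hpr : p * r = r := by rw [hr, ← mul_assoc, hp2]
    have hrp : r * p = r := by rw [hr, hpq, mul_assoc, hp2]
    have hrq : r * q = r := by rw [hr, mul_assoc, hq2]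
    have hqr : q * r = r := by rw [hr, hpq, ← mul_assoc, hq2]
    have hrr : r * r = r := by
      nth_rewrite 1 [hr]
      rw [mul_assoc, hqr, hpr]
    have e1 : p = r + (p - r) := by abel
    have e2 : q = r + (q - r) := by abel
    have s1 : star (p - r) = p - r := by rw [star_sub, hp1, hrs]
    have s2 : star (q - r) = q - r := by rw [star_sub, hq1, hrs]
    have i1 : (p - r) * (p - r) = p - r := by
      simp only [mul_sub, sub_mul, hp2, hpr, hrp, hrr]; abel
    have i2 : (q - r) * (q - r) = q - r := by
      simp only [mul_sub, sub_mul, hq2, hqr, hrq, hrr]; abel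
    rw [e1, e2, Badd, Badd', Badd', Bpp r hrs hrr,
      Bort r (q - r) hrs hrr s2 i2 (by rw [mul_sub, hrq, hrr, sub_self])
        (by rw [sub_mul, hqr, hrr, sub_self]),
      Bort (p - r) r s1 i1 hrs hrr (by rw [sub_mul, hpr, hrr, sub_self])
        (by rw [mul_sub, hrp, hrr, sub_self]),
      Bort (p - r) (q - r) s1 i1 s2 i2
        (by rw [mul_sub, sub_mul, sub_mul, hrq, hpr, hrr, ← hr]; abel)
        (by rw [mul_sub, sub_mul, sub_mul, hqr, hrp, hrr, ← hpq, ← hr]; abel)]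
    simp
  have hmulc : Continuous fun z : M × M => z.1 * z.2 :=
    Continuous.subtype_mk ((continuous_subtype_val.comp continuous_fst).mul
      (continuous_subtype_val.comp continuous_snd)) _
  have haddc : Continuous fun z : M × M => z.1 + z.2 :=
    Continuous.subtype_mk ((continuous_subtype_val.comp continuous_fst).add
      (continuous_subtype_val.comp continuous_snd)) _
  have Bpos : ∀ a : M, 0 ≤ (a : H →L[ℂ] H) → B a a = 0 := by
    intro a ha
    have hWM := bicommProj_subset M a.2
    have hWc : ∀ p ∈ bicommProj (a : H →L[ℂ] H), ∀ q ∈ bicommProj (a : H →L[ℂ] H),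
        p * q = q * p := by
      intro p hp q hq
      have := hp.2.2 _ (Commute.refl (a : H →L[ℂ] H))
      exact (hq.2.2 p this.symm).symm
    have st1 : ∀ x ∈ Submodule.span ℝ (bicommProj (a : H →L[ℂ] H)),
        ∃ hx : x ∈ M, ∀ q (hq : q ∈ bicommProj (a : H →L[ℂ] H)),
          B ⟨x, hx⟩ ⟨q, hWM hq⟩ = 0 := by
      intro x hx
      induction hx using Submodule.span_induction with
      | mem p hp =>
        refine ⟨hWM hp, fun q hq => ?_⟩
        exact Bcomm _ _ (Subtype.ext hp.1) (Subtype.ext hp.2.1) (Subtype.ext hq.1)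
          (Subtype.ext hq.2.1) (Subtype.ext (hWc p hp q hq))
      | zero =>
        refine ⟨zero_mem M, fun q hq => ?_⟩
        have := Bsmul 0 0 ⟨q, hWM hq⟩
        rw [zero_smul, zero_smul] at this
        exact this
      | add x y _ _ ihx ihy =>
        obtain ⟨hx, ihx⟩ := ihx
        obtain ⟨hy, ihy⟩ := ihy
        refine ⟨add_mem hx hy, fun q hq => ?_⟩
        have := Badd ⟨x, hx⟩ ⟨y, hy⟩ ⟨q, hWM hq⟩
        rw [ihx q hq, ihy q hq, add_zero] at this
        exact this
      | smul c x _ ihx =>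
        obtain ⟨hx, ihx⟩ := ihx
        have hc : c • x = (c : ℂ) • x := (RCLike.real_smul_eq_coe_smul (K := ℂ) c x)
        have hm : (c : ℂ) • x ∈ M := SMulMemClass.smul_mem _ hx
        rw [hc]
        refine ⟨hm, fun q hq => ?_⟩
        have := Bsmul (c : ℂ) ⟨x, hx⟩ ⟨q, hWM hq⟩
        rw [ihx q hq, smul_zero] at this
        exact this
    have st2 : ∀ x ∈ Submodule.span ℝ (bicommProj (a : H →L[ℂ] H)),
        ∃ hx : x ∈ M, ∀ y (_ : y ∈ Submodule.span ℝ (bicommProj (a : H →L[ℂ] H))) (hy : y ∈ M),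
          B ⟨y, hy⟩ ⟨x, hx⟩ = 0 := by
      intro x hx
      induction hx using Submodule.span_induction with
      | mem p hp =>
        refine ⟨hWM hp, fun y hy hyM => ?_⟩
        obtain ⟨_, h2⟩ := st1 y hy
        exact h2 p hp
      | zero =>
        refine ⟨zero_mem M, fun y hy hyM => ?_⟩
        have := Bsmul' 0 0 ⟨y, hyM⟩
        rw [zero_smul, zero_smul] at this
        exact this
      | add x y _ _ ihx ihy =>
        obtain ⟨hx, ihx⟩ := ihx
        obtain ⟨hy, ihy⟩ := ihy
        refine ⟨add_mem hx hy, fun z hz hzM => ?_⟩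
        have := Badd' ⟨x, hx⟩ ⟨y, hy⟩ ⟨z, hzM⟩
        rw [ihx z hz, ihy z hz, add_zero] at this
        exact this
      | smul c x _ ihx =>
        obtain ⟨hx, ihx⟩ := ihx
        have hc : c • x = (c : ℂ) • x := (RCLike.real_smul_eq_coe_smul (K := ℂ) c x)
        have hm : (c : ℂ) • x ∈ M := SMulMemClass.smul_mem _ hx
        rw [hc]
        refine ⟨hm, fun z hz hzM => ?_⟩
        have := Bsmul' (c : ℂ) ⟨x, hx⟩ ⟨z, hzM⟩
        rw [ihx z hz, smul_zero] at this
        exact this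
    have hcl := mem_closure_span_bicommProj ha
    let S : Set M := {x | (x : H →L[ℂ] H) ∈ Submodule.span ℝ (bicommProj (a : H →L[ℂ] H))}
    have haS : a ∈ closure S := by
      rw [closure_subtype]
      refine closure_mono ?_ hcl
      intro x hx
      obtain ⟨hxM, _⟩ := st1 x hx
      exact ⟨⟨x, hxM⟩, hx, rfl⟩
    have hclosed : IsClosed {x : M | T (x * x) + T (x * x) =
        T x * x + x * T x + T x * x + x * T x} := by
      have c1 : Continuous fun x : M => T (x * x) :=
        hcont.comp (hmulc.comp (continuous_id.prodMk continuous_id))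
      have c2 : Continuous fun x : M => T x * x :=
        hmulc.comp (hcont.prodMk continuous_id)
      have c3 : Continuous fun x : M => x * T x :=
        hmulc.comp (continuous_id.prodMk hcont)
      exact isClosed_eq (haddc.comp (c1.prodMk c1))
        (haddc.comp ((haddc.comp ((haddc.comp (c2.prodMk c3)).prodMk c2)).prodMk c3))
    have hsub : S ⊆ {x : M | T (x * x) + T (x * x) =
        T x * x + x * T x + T x * x + x * T x} := by
      intro x hx
      obtain ⟨hxM, h2⟩ := st2 x hx
      exact sub_eq_zero.1 (h2 x hx hxM)
    exact sub_eq_zero.2 (closure_minimal hsub hclosed haS)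
  have Bpos2 : ∀ a b : M, 0 ≤ (a : H →L[ℂ] H) → 0 ≤ (b : H →L[ℂ] H) → B a b = 0 := by
    intro a b ha hb
    have e := Bpos (a + b) (add_nonneg ha hb)
    rw [Badd, Badd', Badd', Bpos a ha, Bpos b hb, Bsymm b a, zero_add, add_zero,
      ← two_smul ℂ] at e
    have e2 := congrArg (fun z => (2⁻¹ : ℂ) • z) e
    simpa [smul_smul] using e2
  -- every element is a combination of positive ones
  have hsa : ∀ a : M, star a = a → ∃ x y : M, 0 ≤ (x : H →L[ℂ] H) ∧ 0 ≤ (y : H →L[ℂ] H) ∧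
      a = x + (-1 : ℂ) • y := by
    intro a ha
    have has : IsSelfAdjoint (a : H →L[ℂ] H) := congrArg Subtype.val ha
    have hm : algebraMap ℝ (H →L[ℂ] H) ‖(a : H →L[ℂ] H)‖ ∈ M := by
      rw [Algebra.algebraMap_eq_smul_one, RCLike.real_smul_eq_coe_smul (K := ℂ)]
      exact SMulMemClass.smul_mem _ (one_mem M)
    refine ⟨⟨_, hm⟩, ⟨_, sub_mem hm a.2⟩, ?_, ?_, ?_⟩
    · exact algebraMap_nonneg _ (norm_nonneg _)
    · exact sub_nonneg.2 has.le_algebraMap_norm_self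
    · apply Subtype.ext
      change (a : H →L[ℂ] H) = algebraMap ℝ (H →L[ℂ] H) ‖(a : H →L[ℂ] H)‖ +
        (-1 : ℂ) • (algebraMap ℝ (H →L[ℂ] H) ‖(a : H →L[ℂ] H)‖ - a)
      simp
  have hsa2 : ∀ a b : M, star a = a → star b = b → B a b = 0 := by
    intro a b ha hb
    obtain ⟨x, y, hx, hy, rfl⟩ := hsa a ha
    obtain ⟨z, w, hz, hw, rfl⟩ := hsa b hb
    simp only [Badd, Badd', Bsmul, Bsmul', Bpos2 _ _ hx hz, Bpos2 _ _ hx hw, Bpos2 _ _ hy hz,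
      Bpos2 _ _ hy hw, smul_zero, add_zero]
  have hdec : ∀ a : M, ∃ x y : M, star x = x ∧ star y = y ∧ a = x + Complex.I • y := by
    intro a
    refine ⟨⟨(2⁻¹ : ℂ) • ((a : H →L[ℂ] H) + star (a : H →L[ℂ] H)),
      SMulMemClass.smul_mem _ (add_mem a.2 (star_mem a.2))⟩,
      ⟨(-Complex.I * 2⁻¹ : ℂ) • ((a : H →L[ℂ] H) - star (a : H →L[ℂ] H)),
      SMulMemClass.smul_mem _ (sub_mem a.2 (star_mem a.2))⟩, ?_, ?_, ?_⟩
    · apply Subtype.ext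
      change star ((2⁻¹ : ℂ) • ((a : H →L[ℂ] H) + star (a : H →L[ℂ] H))) = 
        (2⁻¹ : ℂ) • ((a : H →L[ℂ] H) + star (a : H →L[ℂ] H))
      rw [star_smul, star_add, star_star, add_comm]
      simp
    · apply Subtype.ext
      change star ((-Complex.I * 2⁻¹ : ℂ) • ((a : H →L[ℂ] H) - star (a : H →L[ℂ] H))) = 
        (-Complex.I * 2⁻¹ : ℂ) • ((a : H →L[ℂ] H) - star (a : H →L[ℂ] H))
      rw [star_smul, star_sub, star_star, ← neg_sub, smul_neg, ← neg_smul]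
      simp
    · apply Subtype.ext
      change (a : H →L[ℂ] H) = (2⁻¹ : ℂ) • ((a : H →L[ℂ] H) + star (a : H →L[ℂ] H)) +
        Complex.I • ((-Complex.I * 2⁻¹ : ℂ) • ((a : H →L[ℂ] H) - star (a : H →L[ℂ] H)))
      rw [smul_smul, ← mul_assoc, mul_neg, Complex.I_mul_I, neg_neg, one_mul, ← smul_add,
        add_add_sub_cancel, ← two_smul ℂ (a : H →L[ℂ] H), smul_smul]
      simp
  have hB0 : ∀ a b : M, B a b = 0 := by
    intro a b
    obtain ⟨x, y, hx, hy, rfl⟩ := hdec a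
    obtain ⟨z, w, hz, hw, rfl⟩ := hdec b
    simp only [Badd, Badd', Bsmul, Bsmul', hsa2 _ _ hx hz, hsa2 _ _ hx hw, hsa2 _ _ hy hz,
      hsa2 _ _ hy hw, smul_zero, add_zero]
  have h2 : ∀ a : M, a + a = 0 → a = 0 := by
    intro a e
    rw [← two_smul ℂ] at e
    have e2 := congrArg (fun z => (2⁻¹ : ℂ) • z) e
    simpa [smul_smul] using e2
  have hs : ∀ a : M, (∀ x, a * x * a = 0) → a = 0 := by
    intro a e
    have e1 : (a : H →L[ℂ] H) * star (a : H →L[ℂ] H) * a = 0 := congrArg Subtype.val (e (star a))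
    have e2 : star (star (a : H →L[ℂ] H) * a) * (star (a : H →L[ℂ] H) * a) = 0 := by
      rw [star_mul, star_star, mul_assoc, ← mul_assoc (a : H →L[ℂ] H), e1, mul_zero]
    have e3 := CStarRing.star_mul_self_eq_zero_iff _ |>.1 e2
    exact Subtype.ext (CStarRing.star_mul_self_eq_zero_iff _ |>.1 e3)
  intro a b
  refine jd_is_derivation h2 hs ⟨⟨T, T0⟩, Tadd⟩ ?_ a b
  intro x
  have e := hB0 x x
  rw [← sub_eq_zero]
  apply h2
  change T (x * x) - (T x * x + x * T x) + (T (x * x) - (T x * x + x * T x)) = 0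
  rw [← e, hB]
  abel
end

section
/- Every weak-local derivation on a C*-algebra is a derivation; i.e., the space of derivations on a C*-algebra is weak-algebraically reflexive in the space of all linear maps. -/
open scoped ComplexOrder

variable {A : Type*} [NormedRing A] [StarRing A] [CStarRing A] [CompleteSpace A]
  [NormedAlgebra ℂ A] [StarModule ℂ A]

/-- A state on a C*-algebra: a norm-one positive continuous linear functional. -/
def IsState (φ : A →L[ℂ] ℂ) : Prop :=
  ‖φ‖ = 1 ∧ ∀ a : A, 0 ≤ φ (star a * a)

/-- A derivation on a C*-algebra: a linear map satisfying the Leibniz rule. -/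
def IsDerivation (D : A → A) : Prop :=
  IsLinearMap ℂ D ∧ ∀ a b : A, D (a * b) = D a * b + a * D b

/-- A weak-local derivation: a linear map that agrees with some derivation at each point,
up to each state. -/
def IsWeakLocalDerivation (T : A → A) : Prop :=
  IsLinearMap ℂ T ∧ ∀ (a : A) (φ : A →L[ℂ] ℂ), IsState φ →
    ∃ D : A → A, IsDerivation D ∧ φ (T a) = φ (D a)

section Bresar
theorem wl_jordan {R : Type*} [Ring R] (d : R → R)
    (hadd : ∀ a b, d (a + b) = d a + d b)
    (hJ : ∀ a, d (a * a) = d a * a + a * d a)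
    (h2 : ∀ a : R, a + a = 0 → a = 0)
    (hsp : ∀ a : R, (∀ x, a * x * a = 0) → a = 0) :
    ∀ a b, d (a * b) = d a * b + a * d b := by
  have hneg : ∀ a, d (-a) = - d a := by
    intro a
    have h0 : d 0 = 0 := by have := hadd 0 0; simpa using this
    have := hadd a (-a)
    rw [add_neg_cancel, h0] at this
    exact (neg_eq_of_add_eq_zero_right this.symm).symm
  have hsub : ∀ a b, d (a - b) = d a - d b := by
    intro a b; rw [sub_eq_add_neg, hadd, hneg, ← sub_eq_add_neg]
  have cancel2 : ∀ a b : R, a + a = b + b → a = b := by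
    intro a b h
    have : (a - b) + (a - b) = 0 := by
      have : (a - b) + (a - b) = (a + a) - (b + b) := by abel
      rw [this, h, sub_self]
    exact sub_eq_zero.1 (h2 _ this)
  -- Jordan product
  have hJ2 : ∀ a b, d (a * b + b * a) = d a * b + a * d b + d b * a + b * d a := by
    intro a b
    have h := hJ (a + b)
    have e : (a + b) * (a + b) = a * a + b * b + (a * b + b * a) := by noncomm_ring
    rw [e, hadd, hadd, hJ, hJ, hadd] at h
    have := eq_sub_of_add_eq' h
    rw [hadd, this, hadd a b]; noncomm_ring
  have hT : ∀ a b, d (a * b * a) = d a * b * a + a * d b * a + a * b * d a := by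
    intro a b
    apply cancel2
    rw [← hadd]
    have e : a * b * a + a * b * a
      = (a * (a * b + b * a) + (a * b + b * a) * a) - ((a * a) * b + b * (a * a)) := by noncomm_ring
    rw [e, hsub, hJ2, hJ2, hJ2, hJ]
    noncomm_ring
  have hT3 : ∀ a b c, d (a * b * c + c * b * a) = d a * b * c + a * d b * c + a * b * d c
      + d c * b * a + c * d b * a + c * b * d a := by
    intro a b c
    have h := hT (a + c) b
    have e : (a + c) * b * (a + c) = a * b * a + c * b * c + (a * b * c + c * b * a) := by
      noncomm_ring
    rw [e, hadd, hadd, hT, hT, hadd] at h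
    rw [hadd, eq_sub_of_add_eq' h, hadd a c]; noncomm_ring
  -- the defect
  obtain ⟨δ, hδ⟩ : ∃ δ : R → R → R, ∀ a b, δ a b = d (a * b) - d a * b - a * d b :=
    ⟨_, fun _ _ => rfl⟩
  have hδs : ∀ a b, δ b a = - δ a b := by
    intro a b
    have h := hJ2 a b
    rw [hadd] at h
    rw [hδ, hδ, eq_sub_of_add_eq' h]; noncomm_ring
  have hδadd : ∀ a b c, δ (a + c) b = δ a b + δ c b := by
    intro a b c
    rw [hδ, hδ, hδ, add_mul, hadd, hadd]; noncomm_ring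
  have key : ∀ a b x, δ a b * x * (a * b - b * a) + (a * b - b * a) * x * δ a b = 0 := by
    intro a b x
    have h1 := hT3 (a * b) x (b * a)
    have e : a * b * x * (b * a) + b * a * x * (a * b) = a * (b * x * b) * a + b * (a * x * a) * b := by
      noncomm_ring
    rw [e, hadd, hT, hT, hT, hT] at h1
    have e1 : d (a * b) = δ a b + d a * b + a * d b := by rw [hδ]; abel
    have e2 : d (b * a) = - δ a b + d b * a + b * d a := by rw [← hδs, hδ]; abel
    rw [e1, e2] at h1
    rw [← sub_eq_zero] at h1
    rw [← h1]; noncomm_ring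
  have lem : ∀ a b : R, (∀ x, a * x * b + b * x * a = 0) → ∀ x, a * x * b = 0 := by
    intro a b h x
    have h' : ∀ x, b * x * a = - (a * x * b) := fun x => eq_neg_of_add_eq_zero_right (h x)
    apply hsp
    intro y
    apply h2
    have e1 : a * x * b * y * (a * x * b) = a * x * (b * y * a) * x * b := by noncomm_ring
    have e2 : a * x * (-(a * y * b)) * x * b = - (a * (x * a * y) * b) * x * b := by noncomm_ring
    have e3 : b * (x * a * y) * a * x * b = (b * x * a) * y * a * x * b := by noncomm_ring
    have : a * x * b * y * (a * x * b) = - (a * x * b * y * (a * x * b)) := by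
      conv_lhs => rw [e1, h' y, e2, ← h', e3, h' x]
      noncomm_ring
    nth_rewrite 1 [this]
    exact neg_add_cancel _
  have k1 : ∀ a b x, δ a b * x * (a * b - b * a) = 0 := fun a b => lem _ _ (key a b)
  have k2 : ∀ a b c x, δ a b * x * (c * b - b * c) = 0 := by
    intro a b c x
    have hl : ∀ x, δ a b * x * (c * b - b * c) = - (δ c b * x * (a * b - b * a)) := by
      intro x
      have h := k1 (a + c) b x
      rw [hδadd] at h
      have e : (δ a b + δ c b) * x * ((a + c) * b - b * (a + c)) =
        δ a b * x * (a * b - b * a) + δ c b * x * (c * b - b * c)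
          + (δ a b * x * (c * b - b * c) + δ c b * x * (a * b - b * a)) := by noncomm_ring
      rw [e, k1, k1, zero_add, zero_add] at h
      exact eq_neg_of_add_eq_zero_left h
    apply hsp
    intro y
    nth_rewrite 2 [hl x]
    have e : δ a b * x * (c * b - b * c) * y * -(δ c b * x * (a * b - b * a)) =
      - (δ a b * (x * (c * b - b * c) * y * δ c b * x) * (a * b - b * a)) := by noncomm_ring
    rw [e, k1, neg_zero]
  have k2' : ∀ a b c x, δ a b * x * (c * a - a * c) = 0 := by
    intro a b c x
    have := k2 b a c x
    rw [hδs a b] at this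
    simpa using this
  have k3 : ∀ a b c e x, δ a b * x * (c * e - e * c) = 0 := by
    intro a b c e x
    have hδadd' : ∀ a b c, δ a (b + c) = δ a b + δ a c := by
      intro a b c
      rw [hδs (b + c) a, hδadd, hδs a b, hδs a c]; abel
    have hl : ∀ x, δ a b * x * (c * e - e * c) = - (δ a e * x * (c * b - b * c)) := by
      intro x
      have h := k2 a (b + e) c x
      rw [hδadd'] at h
      have e : (δ a b + δ a e) * x * (c * (b + e) - (b + e) * c) =
        δ a b * x * (c * b - b * c) + δ a e * x * (c * e - e * c)
          + (δ a b * x * (c * e - e * c) + δ a e * x * (c * b - b * c)) := by noncomm_ring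
      rw [e, k2, k2, zero_add, zero_add] at h
      exact eq_neg_of_add_eq_zero_left h
    apply hsp
    intro y
    nth_rewrite 2 [hl x]
    have e : δ a b * x * (c * e - e * c) * y * -(δ a e * x * (c * b - b * c)) =
      - (δ a b * (x * (c * e - e * c) * y * δ a e * x) * (c * b - b * c)) := by noncomm_ring
    rw [e, k2, neg_zero]
  intro a b
  have k3' : ∀ c e, δ a b * (c * e - e * c) = 0 := by
    intro c e; simpa using k3 a b c e 1
  have hcen : ∀ c, δ a b * c = c * δ a b := by
    intro c
    rw [← sub_eq_zero]
    apply hsp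
    intro x
    have e : (δ a b * c - c * δ a b) * x * (δ a b * c - c * δ a b) =
      δ a b * (c * x) * (δ a b * c - c * δ a b) - c * (δ a b * x * (δ a b * c - c * δ a b)) := by
      noncomm_ring
    rw [e, k3, k3]; simp
  set z := δ a b with hz
  have t1 : z + z = d (a * b - b * a) - (d a * b - b * d a) - (a * d b - d b * a) := by
    have : z + z = δ a b - δ b a := by rw [hδs a b]; abel
    rw [this, hδ, hδ, hsub]; abel
  have t2 : z * (z + z) = z * d (a * b - b * a) := by
    rw [t1, mul_sub, mul_sub, k3', k3', sub_zero, sub_zero]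
  have t3 : z * (z * d (a * b - b * a)) = 0 := by
    have h := hJ2 z (a * b - b * a)
    rw [← hcen, k3'] at h
    have h0 : d (0 + 0) = 0 := by have := hadd 0 0; simpa using this
    rw [h0] at h
    have h' := congrArg (z * ·) h
    simp only [mul_add, mul_zero] at h'
    rw [← mul_assoc z (d z), k3, ← mul_assoc z (a * b - b * a), k3', ← hcen (d (a * b - b * a))] at h'
    simp only [zero_mul, zero_add, add_zero] at h'
    exact h2 _ h'.symm
  rw [← t2] at t3
  have t4 : z * z * z = 0 := by
    apply h2
    rw [← t3]; noncomm_ring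
  have t5 : z * z = 0 := by
    apply hsp
    intro x
    calc z * z * x * (z * z) = z * (z * x) * z * z := by noncomm_ring
      _ = (z * x) * z * z * z := by rw [hcen (z * x)]
      _ = z * x * (z * z * z) := by noncomm_ring
      _ = 0 := by rw [t4, mul_zero]
  have t6 : z = 0 := by
    apply hsp
    intro x
    rw [hcen x, mul_assoc, t5, mul_zero]
  rw [hz, hδ, sub_sub, sub_eq_zero] at t6
  exact t6
end Bresar

section States
variable {B : Type*} [CStarAlgebra B] [PartialOrder B] [StarOrderedRing B]

theorem wl_im_eq_zero [Nontrivial B] (g : B →L[ℂ] ℂ) (h1 : g 1 = 1) (hn : ‖g‖ ≤ 1) (a : B)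
    (ha : IsSelfAdjoint a) : (g a).im = 0 := by
  have hle : ∀ x, ‖g x‖ ≤ ‖x‖ := fun x => (g.le_of_opNorm_le hn x).trans_eq (one_mul _)
  have key : ∀ t : ℝ, 2 * (g a).im * t ≤ ‖a‖ ^ 2 := by
    intro t
    let x : B := a + (Complex.I * t) • (1 : B)
    have hx : star x * x = a * a + ((t ^ 2 : ℝ) : ℂ) • (1 : B) := by
      have : star x = a - (Complex.I * t) • (1 : B) := by
        simp [x, ha.star_eq, sub_eq_add_neg]
      rw [this]
      simp only [x, sub_mul, mul_add, mul_smul_comm, smul_mul_assoc, mul_one, one_mul, smul_sub, smul_smul]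
      have : (Complex.I * t * (Complex.I * t)) = - ((t ^ 2 : ℝ) : ℂ) := by
        push_cast
        linear_combination (t : ℂ) ^ 2 * Complex.I_mul_I
      rw [this, neg_smul]; abel
    have h2 : ‖x‖ ^ 2 ≤ ‖a‖ ^ 2 + t ^ 2 := by
      rw [sq, ← CStarRing.norm_star_mul_self, hx]
      refine (norm_add_le _ _).trans (add_le_add ?_ ?_)
      · rw [sq]; exact norm_mul_le _ _
      · rw [norm_smul, norm_one, mul_one, Complex.norm_real, Real.norm_of_nonneg (sq_nonneg t)]
    have h3 : g x = g a + Complex.I * t := by simp [x, h1]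
    have h4 : |(g x).im| ≤ ‖x‖ := (Complex.abs_im_le_norm _).trans (hle x)
    have h5 : (g x).im = (g a).im + t := by rw [h3]; simp
    have h6 : (g x).im ^ 2 ≤ ‖x‖ ^ 2 := by
      rw [← sq_abs]; exact pow_le_pow_left₀ (abs_nonneg _) h4 2
    rw [h5] at h6
    nlinarith [sq_nonneg (g a).im]
  by_contra hne
  have := key ((‖a‖ ^ 2 + 1) / (2 * (g a).im))
  rw [mul_div_cancel₀ _ (by simpa using hne)] at this
  linarith

theorem wl_state_nonneg [Nontrivial B] (g : B →L[ℂ] ℂ) (h1 : g 1 = 1) (hn : ‖g‖ ≤ 1) (a : B)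
    (ha : 0 ≤ a) : 0 ≤ g a := by
  have hle : ∀ x, ‖g x‖ ≤ ‖x‖ := fun x => (g.le_of_opNorm_le hn x).trans_eq (one_mul _)
  have hs : IsSelfAdjoint a := .of_nonneg ha
  rw [Complex.le_def]
  refine ⟨?_, by simpa using (wl_im_eq_zero g h1 hn a hs).symm⟩
  have hm : ‖algebraMap ℝ B ‖a‖ - a‖ ≤ ‖a‖ := by
    rw [CStarAlgebra.norm_le_iff_le_algebraMap _ (norm_nonneg a)
      (sub_nonneg.2 hs.le_algebraMap_norm_self)]
    exact sub_le_self _ ha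
  have h := (Complex.re_le_norm _).trans ((hle _).trans hm)
  have e : g (algebraMap ℝ B ‖a‖) = (‖a‖ : ℂ) := by
    rw [Algebra.algebraMap_eq_smul_one, ← Complex.coe_smul, map_smul, h1]; simp
  rw [map_sub, e] at h
  simp at h
  simpa using h

theorem wl_exists_state [Nontrivial B] (y : B) (hy : IsSelfAdjoint y) (hu : ¬ IsUnit y) :
    ∃ φ : B →L[ℂ] ℂ, IsState φ ∧ φ 1 = 1 ∧ φ y = 0 := by
  have : IsStarNormal y := hy.isStarNormal
  let y' : StarAlgebra.elemental ℂ y := ⟨y, StarAlgebra.elemental.self_mem ℂ y⟩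
  have hu' : ¬ IsUnit y' := fun h => hu (h.map (StarAlgebra.elemental ℂ y).subtype)
  obtain ⟨χ, hχ⟩ := WeakDual.CharacterSpace.exists_apply_eq_zero hu'
  let f : StrongDual ℂ (StarAlgebra.elemental ℂ y) := WeakDual.toStrongDual χ.1
  have hf : ‖f‖ ≤ 1 := by
    have := WeakDual.CharacterSpace.norm_le_norm_one χ
    exact this.trans_eq norm_one
  obtain ⟨g, hg, hgn⟩ := exists_extension_norm_eq (StarAlgebra.elemental ℂ y).toSubalgebra.toSubmodule f
  have g1 : g 1 = 1 := (hg (1 : StarAlgebra.elemental ℂ y)).trans (map_one χ)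
  have gn : ‖g‖ ≤ 1 := hgn.trans_le hf
  refine ⟨g, ⟨le_antisymm gn ?_, fun a => ?_⟩, g1, (hg y').trans hχ⟩
  · have := g.le_opNorm 1
    simpa [g1] using this
  · exact wl_state_nonneg g g1 gn _ (star_mul_self_nonneg a)

theorem wl_CS (φ : B →L[ℂ] ℂ) (hφ : ∀ a, 0 ≤ φ (star a * a)) (s : B) (hs : φ (star s * s) = 0)
    (y : B) : φ (y * s) = 0 ∧ φ (star s * y) = 0 := by
  have hpos : ∀ x, 0 ≤ x → 0 ≤ φ x := by
    intro x hx
    obtain ⟨c, rfl⟩ := CStarAlgebra.nonneg_iff_eq_star_mul_self.1 hx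
    exact hφ c
  let f : B →ₚ[ℂ] ℂ := PositiveLinearMap.mk₀ (φ : B →ₗ[ℂ] ℂ) hpos
  have hn : ‖f.toPreGNS s‖ = 0 := by
    have := f.preGNS_norm_sq (f.toPreGNS s)
    have h2 : f (star s * s) = 0 := hs
    simp only [PositiveLinearMap.ofPreGNS_toPreGNS, h2] at this
    simpa using this
  have h : ∀ y, inner ℂ (f.toPreGNS y) (f.toPreGNS s) = 0 ∧ inner ℂ (f.toPreGNS s) (f.toPreGNS y) = 0 := by
    intro y
    have h1 := norm_inner_le_norm (𝕜 := ℂ) (f.toPreGNS y) (f.toPreGNS s)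
    have h2 := norm_inner_le_norm (𝕜 := ℂ) (f.toPreGNS s) (f.toPreGNS y)
    rw [hn] at h1 h2
    constructor
    · simpa using h1
    · simpa using h2
  constructor
  · have := (h (star y)).1
    rw [PositiveLinearMap.preGNS_inner_def] at this
    simp only [PositiveLinearMap.ofPreGNS_toPreGNS, star_star] at this
    exact this
  · have := (h y).2
    rw [PositiveLinearMap.preGNS_inner_def] at this
    simp only [PositiveLinearMap.ofPreGNS_toPreGNS] at this
    exact this
end States

section Kadison

/-- The hat function centred at the integer `i`. -/
noncomputable def wlHat (i : ℤ) (x : ℝ) : ℝ := max 0 (1 - |x - i|)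

theorem wlHat_nonneg (i : ℤ) (x : ℝ) : 0 ≤ wlHat i x := le_max_left _ _

theorem wlHat_continuous (i : ℤ) : Continuous (wlHat i) := by
  unfold wlHat; fun_prop

theorem wlHat_sum (K : ℕ) (x : ℝ) (hx : |x| ≤ K) (f : ℤ → ℝ) :
    ∑ i ∈ Finset.Icc (-(K : ℤ)) (K + 1), f i * wlHat i x
      = f ⌊x⌋ * (1 - (x - ⌊x⌋)) + f (⌊x⌋ + 1) * (x - ⌊x⌋) := by
  have h1 := Int.floor_le x
  have h2 := Int.lt_floor_add_one x
  obtain ⟨h3, h4⟩ := abs_le.1 hx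
  set n := ⌊x⌋ with hn
  have hsub : ({n, n + 1} : Finset ℤ) ⊆ Finset.Icc (-(K : ℤ)) (K + 1) := by
    have a1 : -(K : ℤ) ≤ n := by rw [hn, Int.le_floor]; push_cast; linarith
    have a2 : n ≤ K := by
      have : (n : ℝ) ≤ K := h1.trans h4
      exact_mod_cast this
    intro j hj
    simp only [Finset.mem_insert, Finset.mem_singleton] at hj
    rw [Finset.mem_Icc]
    omega
  rw [← Finset.sum_subset hsub, Finset.sum_pair (by simp)]
  · congr 2
    · unfold wlHat
      rw [abs_of_nonneg (by linarith), max_eq_right (by linarith)]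
    · unfold wlHat
      push_cast
      rw [abs_of_nonpos (by linarith), max_eq_right (by linarith)]
      ring
  · intro j _ hj
    simp only [Finset.mem_insert, Finset.mem_singleton, not_or] at hj
    have : wlHat j x = 0 := by
      unfold wlHat
      apply max_eq_left
      rw [sub_nonpos, le_abs]
      rcases lt_or_gt_of_ne hj.1 with h | h
      · left
        have : (j : ℝ) + 1 ≤ n := by exact_mod_cast h
        linarith
      · right
        have : n + 2 ≤ j := by omega
        have : (n : ℝ) + 2 ≤ j := by exact_mod_cast this
        linarith
    rw [this, mul_zero]

variable {B : Type*} [CStarAlgebra B] [PartialOrder B] [StarOrderedRing B]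

theorem wl_kadison_aux (Φ : B →ₗ[ℂ] B) (hpos : ∀ x, 0 ≤ x → 0 ≤ Φ x) (h1 : Φ 1 = 1) (a : B)
    (ha : IsSelfAdjoint a) : Φ a * Φ a ≤ Φ (a * a) + 1 := by
  obtain ⟨K, hK⟩ := exists_nat_ge (‖a‖ * ‖(1 : B)‖)
  set s := Finset.Icc (-(K : ℤ)) (K + 1)
  have hspec : ∀ x ∈ spectrum ℝ a, |x| ≤ K := fun x hx =>
    (spectrum.norm_le_norm_mul_of_mem hx).trans hK
  have hc : ∀ i, ContinuousOn (wlHat i) (spectrum ℝ a) := fun i => (wlHat_continuous i).continuousOn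
  have hsum : ∀ c : ℤ → ℤ, ∑ i ∈ s, c i • cfc (wlHat i) a
      = cfc (fun x => ∑ i ∈ s, (c i : ℝ) * wlHat i x) a := by
    intro c
    have e : (fun x => ∑ i ∈ s, (c i : ℝ) * wlHat i x)
        = ∑ i ∈ s, fun x => (c i : ℝ) * wlHat i x := by ext x; simp
    rw [e, cfc_sum (fun i x => (c i : ℝ) * wlHat i x) a s
      (fun i _ => ((wlHat_continuous i).const_mul _).continuousOn)]
    refine Finset.sum_congr rfl fun i _ => ?_
    rw [cfc_const_mul _ _ a (hc i), Int.cast_smul_eq_zsmul]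
  have e1 : ∑ i ∈ s, cfc (wlHat i) a = 1 := by
    have := hsum (fun _ => 1)
    simp only [one_smul] at this
    rw [this, ← cfc_one ℝ a]
    refine cfc_congr fun x hx => ?_
    have := wlHat_sum K x (hspec x hx) (fun _ => ((1 : ℤ) : ℝ))
    refine this.trans ?_
    simp
  have e2 : ∑ i ∈ s, i • cfc (wlHat i) a = a := by
    conv_rhs => rw [← cfc_id ℝ a]
    rw [hsum (fun i => i)]
    refine cfc_congr fun x hx => ?_
    have := wlHat_sum K x (hspec x hx) (fun i => (i : ℝ))
    refine this.trans ?_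
    push_cast
    simp only [id]
    ring
  have e3 : ∑ i ∈ s, (i * i) • cfc (wlHat i) a ≤ a * a + 1 := by
    have : a * a + 1 = cfc (fun x : ℝ => x * x + 1) a := by
      rw [cfc_add_const (1 : ℝ) (fun x => x * x) a (by fun_prop) ha,
        cfc_mul (fun x => x) (fun x => x) a, cfc_id' ℝ a, map_one]
    rw [this, hsum (fun i => i * i)]
    refine cfc_mono (fun x hx => ?_) ?_ ?_
    · have := wlHat_sum K x (hspec x hx) (fun i => ((i * i : ℤ) : ℝ))
      refine this.trans_le ?_
      push_cast
      nlinarith [Int.floor_le x, Int.lt_floor_add_one x]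
    · exact (continuous_finsetSum _ fun i _ => (wlHat_continuous i).const_mul _).continuousOn
    · fun_prop
  obtain ⟨F, hF⟩ : ∃ F : ℤ → B, ∀ i, F i = Φ (cfc (wlHat i) a) := ⟨_, fun _ => rfl⟩
  have hF0 : ∀ i, 0 ≤ F i := fun i => by
    rw [hF]; exact hpos _ (cfc_nonneg fun x _ => wlHat_nonneg i x)
  have f1 : ∑ i ∈ s, F i = 1 := by
    rw [← h1, ← e1, map_sum]; simp only [hF]
  obtain ⟨b, hb⟩ : ∃ b, b = Φ a := ⟨_, rfl⟩
  have f2 : ∑ i ∈ s, i • F i = b := by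
    conv_rhs => rw [hb, ← e2, map_sum]
    simp only [hF, map_zsmul]
  have f3 : ∑ i ∈ s, (i * i) • F i ≤ Φ (a * a) + 1 := by
    have := hpos _ (sub_nonneg.2 e3)
    rw [map_sub, sub_nonneg, map_add, h1, map_sum] at this
    simpa only [hF, map_zsmul] using this
  have hbs : IsSelfAdjoint b := by
    rw [← f2]
    exact isSelfAdjoint_sum _ fun i _ => by
      have := (IsSelfAdjoint.of_nonneg (hF0 i)).star_eq
      rw [IsSelfAdjoint, star_zsmul, this]
  rw [← hb]
  refine le_trans (sub_nonneg.1 ?_) f3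
  have : ∑ i ∈ s, (i * i) • F i - b * b = ∑ i ∈ s, (i • 1 - b) * F i * (i • 1 - b) := by
    have : ∀ i, (i • 1 - b) * F i * (i • 1 - b)
        = (i * i) • F i - b * (i • F i) - (i • F i) * b + b * F i * b := by
      intro i
      simp only [sub_mul, mul_sub, smul_mul_assoc, mul_smul_comm, one_mul, mul_one, smul_sub,
        smul_smul]
      abel
    simp only [this]
    rw [Finset.sum_add_distrib, Finset.sum_sub_distrib, Finset.sum_sub_distrib, ← Finset.mul_sum,
      ← Finset.sum_mul, ← Finset.sum_mul, ← Finset.mul_sum, f1, f2]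
    simp
  rw [this]
  refine Finset.sum_nonneg fun i _ => ?_
  have hs : IsSelfAdjoint (i • (1 : B) - b) := by
    refine IsSelfAdjoint.sub ?_ hbs
    simp [IsSelfAdjoint]
  have := star_left_conjugate_nonneg (hF0 i) (i • (1 : B) - b)
  rwa [hs.star_eq] at this

theorem wl_kadison (Φ : B →ₗ[ℂ] B) (hpos : ∀ x, 0 ≤ x → 0 ≤ Φ x) (h1 : Φ 1 = 1) (a : B)
    (ha : IsSelfAdjoint a) : Φ a * Φ a ≤ Φ (a * a) := by
  rw [← sub_nonneg]
  have h : ∀ n : ℕ, 0 ≤ Φ (a * a) - Φ a * Φ a + ((1 / ((n : ℝ) + 1)) ^ 2) • (1 : B) := by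
    intro n
    obtain ⟨c, hcdef⟩ : ∃ c : ℝ, c = (n : ℝ) + 1 := ⟨_, rfl⟩
    rw [← hcdef]
    have hn : 0 < c := by rw [hcdef]; positivity
    have h := wl_kadison_aux Φ hpos h1 (c • a) (by rw [IsSelfAdjoint, star_smul, ha.star_eq]; simp)
    rw [smul_mul_smul_comm, LinearMap.map_smul_of_tower, LinearMap.map_smul_of_tower,
      smul_mul_smul_comm] at h
    have h' := smul_nonneg (sq_nonneg (1 / c)) (sub_nonneg.2 h)
    have e : (1 / c) ^ 2 • ((c * c) • Φ (a * a) + 1 - (c * c) • (Φ a * Φ a))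
        = Φ (a * a) - Φ a * Φ a + ((1 / c) ^ 2) • (1 : B) := by
      have : (1 / c) ^ 2 * (c * c) = 1 := by field_simp
      rw [smul_sub, smul_add, smul_smul, smul_smul, this, one_smul, one_smul]
      abel
    rwa [e] at h'
  have ht : Filter.Tendsto
      (fun n : ℕ => Φ (a * a) - Φ a * Φ a + ((1 / ((n : ℝ) + 1)) ^ 2) • (1 : B))
      Filter.atTop (nhds (Φ (a * a) - Φ a * Φ a + ((0 : ℝ) ^ 2) • (1 : B))) :=
    tendsto_const_nhds.add ((tendsto_one_div_add_atTop_nhds_zero_nat.pow 2).smul_const _)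
  rw [zero_pow two_ne_zero, zero_smul, add_zero] at ht
  exact ge_of_tendsto' ht h
end Kadison

section Main
variable {B : Type*} [CStarAlgebra B] [PartialOrder B] [StarOrderedRing B]

theorem wl_min [Nontrivial B] (x : B) (hx : IsSelfAdjoint x) :
    ∃ (m : ℝ) (φ : B →L[ℂ] ℂ), IsState φ ∧ φ 1 = 1 ∧ algebraMap ℝ B m ≤ x ∧ φ x = m := by
  obtain ⟨m, hm, hmin⟩ := (spectrum.isCompact (𝕜 := ℝ) x).exists_isMinOn
    (ContinuousFunctionalCalculus.spectrum_nonempty (R := ℝ) x hx) continuous_id.continuousOn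
  have hle : algebraMap ℝ B m ≤ x := algebraMap_le_of_le_spectrum (fun y hy => hmin hy) hx
  have hs : IsSelfAdjoint (algebraMap ℝ B m - x) := by
    refine IsSelfAdjoint.sub ?_ hx
    simp [IsSelfAdjoint, Algebra.algebraMap_eq_smul_one]
  obtain ⟨φ, h1, h2, h3⟩ := wl_exists_state _ hs (spectrum.mem_iff.1 hm)
  refine ⟨m, φ, h1, h2, hle, ?_⟩
  rw [map_sub, sub_eq_zero] at h3
  rw [← h3, Algebra.algebraMap_eq_smul_one, ← Complex.coe_smul, map_smul, h2]; simp

theorem wl_T_one [Nontrivial B] (T : B →ₗ[ℂ] B) (hstar : ∀ x, T (star x) = star (T x))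
    (h1 : ∀ φ : B →L[ℂ] ℂ, IsState φ → φ (T 1) = 0) : T 1 = 0 := by
  have key : ∀ x : B, IsSelfAdjoint x → (∀ φ : B →L[ℂ] ℂ, IsState φ → φ x = 0) → 0 ≤ x := by
    intro x hx h
    obtain ⟨m, φ, hφ, -, hle, hm⟩ := wl_min x hx
    rw [h φ hφ] at hm
    have : m = 0 := by exact_mod_cast hm.symm
    simpa [this] using hle
  have hs : IsSelfAdjoint (T 1) := by
    rw [IsSelfAdjoint, ← hstar, star_one]
  refine le_antisymm ?_ (key _ hs h1)
  rw [← neg_nonneg]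
  exact key _ hs.neg (fun φ hφ => by rw [map_neg, h1 φ hφ, neg_zero])

theorem wl_pos [Nontrivial B] (T : B →ₗ[ℂ] B) (hT1 : T 1 = 0)
    (hP : ∀ b, 0 ≤ b → ∀ φ : B →L[ℂ] ℂ, IsState φ → φ b = 0 → φ (T b) = 0)
    (t : ℝ) (x : B) (hx : IsSelfAdjoint x) (h : 0 ≤ x - t • T x) : 0 ≤ x := by
  obtain ⟨m, φ, hφ, h1, hle, hm⟩ := wl_min x hx
  have e : φ (algebraMap ℝ B m) = m := by
    rw [Algebra.algebraMap_eq_smul_one, ← Complex.coe_smul, map_smul, h1]; simp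
  have e2 : T (algebraMap ℝ B m) = 0 := by
    rw [Algebra.algebraMap_eq_smul_one, ← Complex.coe_smul, map_smul, hT1, smul_zero]
  have h2 := hP _ (sub_nonneg.2 hle) φ hφ (by rw [map_sub, e, hm, sub_self])
  rw [map_sub, e2, sub_zero] at h2
  obtain ⟨c, hc⟩ := CStarAlgebra.nonneg_iff_eq_star_mul_self.1 h
  have h3 := hφ.2 c
  rw [← hc, map_sub, ← Complex.coe_smul, map_smul, h2, smul_zero, sub_zero, hm] at h3
  have h4 : 0 ≤ m := by exact_mod_cast h3
  exact le_trans (algebraMap_nonneg B h4) hle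

theorem wl_norm [Nontrivial B] (T : B →ₗ[ℂ] B) (hT1 : T 1 = 0)
    (hstar : ∀ x, T (star x) = star (T x))
    (hP : ∀ b, 0 ≤ b → ∀ φ : B →L[ℂ] ℂ, IsState φ → φ b = 0 → φ (T b) = 0)
    (t : ℝ) (x : B) (hx : IsSelfAdjoint x) : ‖x‖ ≤ ‖x - t • T x‖ := by
  obtain ⟨c, hc⟩ : ∃ c, c = ‖x - t • T x‖ := ⟨_, rfl⟩
  have hTs : IsSelfAdjoint (x - t • T x) := by
    refine hx.sub ?_
    rw [IsSelfAdjoint, star_smul, ← hstar, hx.star_eq]; simp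
  have hcs : IsSelfAdjoint (algebraMap ℝ B c) := by
    simp [IsSelfAdjoint, Algebra.algebraMap_eq_smul_one]
  have e2 : T (algebraMap ℝ B c) = 0 := by
    rw [Algebra.algebraMap_eq_smul_one, ← Complex.coe_smul, map_smul, hT1, smul_zero]
  have h1 : 0 ≤ algebraMap ℝ B c - x := by
    apply wl_pos T hT1 hP t _ (hcs.sub hx)
    rw [map_sub, e2]
    have := sub_nonneg.2 hTs.le_algebraMap_norm_self
    rw [← hc] at this
    convert this using 1
    simp; abel
  have h2 : 0 ≤ algebraMap ℝ B c + x := by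
    apply wl_pos T hT1 hP t _ (hcs.add hx)
    rw [map_add, e2]
    have := sub_nonneg.2 hTs.neg_algebraMap_norm_le_self
    rw [← hc] at this
    convert this using 1
    simp; abel
  rw [← hc]
  have hc0 : 0 ≤ c := hc ▸ norm_nonneg _
  have hu := (le_algebraMap_iff_spectrum_le (R := ℝ) hx).1 (sub_nonneg.1 h1)
  have hl := (algebraMap_le_iff_le_spectrum (R := ℝ) (r := -c) hx).1
    (by rw [map_neg, neg_le_iff_add_nonneg']; exact h2)
  rcases CStarAlgebra.norm_or_neg_norm_mem_spectrum (a := x) hx with h | h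
  · exact hu _ h
  · have := hl _ h
    linarith

theorem wl_continuous [Nontrivial B] (T : B →ₗ[ℂ] B) (hT1 : T 1 = 0)
    (hstar : ∀ x, T (star x) = star (T x))
    (hP : ∀ b, 0 ≤ b → ∀ φ : B →L[ℂ] ℂ, IsState φ → φ b = 0 → φ (T b) = 0) :
    Continuous T := by
  have C : ∀ (v : ℕ → B) (w : B), (∀ n, IsSelfAdjoint (v n)) →
      Filter.Tendsto v Filter.atTop (nhds 0) →
      Filter.Tendsto (fun n => T (v n)) Filter.atTop (nhds w) → w = 0 := by
    intro v w hv h0 hw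
    have hws : IsSelfAdjoint w := by
      have h1 : Filter.Tendsto (fun n => star (T (v n))) Filter.atTop (nhds (star w)) :=
        hw.star
      have : (fun n => star (T (v n))) = fun n => T (v n) := by
        ext n; rw [← hstar, (hv n).star_eq]
      rw [this] at h1
      exact tendsto_nhds_unique h1 hw
    have key : ∀ t : ℝ, 0 < t → ‖w‖ ≤ t * ‖T w‖ := by
      intro t ht
      have h : ∀ n, ‖v n + t • w‖ ≤ ‖(v n + t • w) - t • (T (v n) + t • T w)‖ := by
        intro n
        have := wl_norm T hT1 hstar hP t (v n + t • w)
          ((hv n).add (by rw [IsSelfAdjoint, star_smul, hws.star_eq]; simp))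
        rwa [map_add, LinearMap.map_smul_of_tower] at this
      have l1 : Filter.Tendsto (fun n => ‖v n + t • w‖) Filter.atTop (nhds ‖0 + t • w‖) :=
        (h0.add_const _).norm
      have l2 : Filter.Tendsto (fun n => ‖(v n + t • w) - t • (T (v n) + t • T w)‖) Filter.atTop
          (nhds ‖(0 + t • w) - t • (w + t • T w)‖) :=
        ((h0.add_const _).sub ((hw.add_const _).const_smul t)).norm
      have := le_of_tendsto_of_tendsto' l1 l2 h
      have e : (0 + t • w) - t • (w + t • T w) = - (t • t • T w) := by
        rw [smul_add, zero_add]; abel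
      rw [e, zero_add, norm_neg, norm_smul, norm_smul, norm_smul, Real.norm_of_nonneg ht.le] at this
      exact le_of_mul_le_mul_left this ht
    by_contra hne
    have hp : 0 < ‖w‖ := norm_pos_iff.2 hne
    have hq : 0 < ‖T w‖ + 1 := by positivity
    have := key (‖w‖ / (2 * (‖T w‖ + 1))) (by positivity)
    have h3 : ‖w‖ / (2 * (‖T w‖ + 1)) * ‖T w‖ ≤ ‖w‖ / 2 := by
      rw [div_mul_eq_mul_div, div_le_div_iff₀ (by positivity) (by positivity)]
      nlinarith [norm_nonneg (T w)]
    linarith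
  refine T.continuous_of_seq_closed_graph fun u x y hu hTu => ?_
  have hv : Filter.Tendsto (fun n => u n - x) Filter.atTop (nhds 0) := by
    simpa using hu.sub_const x
  have hTv : Filter.Tendsto (fun n => T (u n - x)) Filter.atTop (nhds (y - T x)) := by
    simpa using hTu.sub_const (T x)
  have hsv : Filter.Tendsto (fun n => star (u n - x)) Filter.atTop (nhds 0) := by
    have := hv.star; rwa [star_zero] at this
  have c1 := C (fun n => (u n - x) + star (u n - x)) ((y - T x) + star (y - T x))
    (fun n => by simp only [IsSelfAdjoint, star_add, star_star]; exact add_comm _ _)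
    (by simpa using hv.add hsv)
    (by
      have := hTv.add hTv.star
      simpa only [map_add, hstar] using this)
  have c2 := C (fun n => Complex.I • ((u n - x) - star (u n - x)))
    (Complex.I • ((y - T x) - star (y - T x)))
    (fun n => by simp [IsSelfAdjoint, star_smul]; rw [← smul_neg]; congr 1; abel)
    (by simpa using (hv.sub hsv).const_smul Complex.I)
    (by
      have := (hTv.sub hTv.star).const_smul Complex.I
      simpa only [map_smul, map_sub, hstar] using this)
  have c3 : (y - T x) - star (y - T x) = 0 := by
    rcases smul_eq_zero.1 c2 with h | h
    · exact absurd h Complex.I_ne_zero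
    · exact h
  have c4 : (2 : ℂ) • (y - T x) = 0 := by
    rw [two_smul]
    calc (y - T x) + (y - T x) = ((y - T x) + star (y - T x)) + ((y - T x) - star (y - T x)) := by
          abel
      _ = 0 := by rw [c1, c3, add_zero]
  rcases smul_eq_zero.1 c4 with h | h
  · norm_num at h
  · exact sub_eq_zero.1 h

theorem wl_jordan_sa [Nontrivial B] (T : B →ₗ[ℂ] B) (hT1 : T 1 = 0)
    (hstar : ∀ x, T (star x) = star (T x))
    (hP : ∀ b, 0 ≤ b → ∀ φ : B →L[ℂ] ℂ, IsState φ → φ b = 0 → φ (T b) = 0)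
    (b : B) (hb : IsSelfAdjoint b) : T (b * b) = T b * b + b * T b := by
  let S : B →L[ℂ] B := ⟨T, wl_continuous T hT1 hstar hP⟩
  have hS : ∀ x, S x = T x := fun _ => rfl
  obtain ⟨Y, hY⟩ : ∃ Y, Y = T (b * b) - (T b * b + b * T b) := ⟨_, rfl⟩
  obtain ⟨Z, hZ⟩ : ∃ Z, Z = T b * T b := ⟨_, rfl⟩
  let R : ℝ → (B →L[ℂ] B) := fun t => Ring.inverse (1 - (t : ℂ) • S)
  have hcont : Filter.Tendsto (fun t : ℝ => 1 - (t : ℂ) • S) (nhds 0) (nhds 1) := by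
    have : Continuous (fun t : ℝ => 1 - (t : ℂ) • S) := by fun_prop
    exact this.tendsto' 0 1 (by ext x; simp)
  have hunit : ∀ᶠ t : ℝ in nhds 0, IsUnit (1 - (t : ℂ) • S) :=
    hcont.eventually (Units.nhds (1 : (B →L[ℂ] B)ˣ))
  have hR : Filter.Tendsto R (nhds 0) (nhds 1) := by
    have h := (NormedRing.inverse_continuousAt (1 : (B →L[ℂ] B)ˣ)).tendsto
    rw [Units.val_one, Ring.inverse_one] at h
    exact h.comp hcont
  have hg : Filter.Tendsto (fun t : ℝ => R t (Y + t • Z)) (nhds 0) (nhds Y) := by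
    have h1 : Filter.Tendsto (fun t : ℝ => Y + t • Z) (nhds 0) (nhds Y) := by
      have : Continuous (fun t : ℝ => Y + t • Z) := by fun_prop
      simpa using this.tendsto 0
    have h2 := (isBoundedBilinearMap_apply (𝕜 := ℂ) (E := B) (F := B)).continuous.tendsto (1, Y)
    exact h2.comp (hR.prodMk_nhds h1)
  have key : ∀ᶠ t : ℝ in nhds 0, 0 ≤ t • R t (Y + t • Z) := by
    filter_upwards [hunit] with t ht
    have i1 : ∀ x, R t (x - t • T x) = x := by
      intro x
      have := congrArg (fun F : B →L[ℂ] B => F x) (Ring.inverse_mul_cancel _ ht)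
      simpa [hS] using this
    have i2 : ∀ x, R t x - t • T (R t x) = x := by
      intro x
      have := congrArg (fun F : B →L[ℂ] B => F x) (Ring.mul_inverse_cancel _ ht)
      simpa [hS] using this
    have hpos : ∀ x, 0 ≤ x → 0 ≤ R t x := by
      intro x hx
      refine wl_pos T hT1 hP t _ ?_ (by rw [i2]; exact hx)
      have h1 := congrArg star (i2 x)
      rw [star_sub, star_smul, ← hstar, (IsSelfAdjoint.of_nonneg hx).star_eq, star_trivial t] at h1
      rw [IsSelfAdjoint, ← i1 (star (R t x)), h1]
    have h1 : R t 1 = 1 := by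
      have := i1 1
      rwa [hT1, smul_zero, sub_zero] at this
    have hk := wl_kadison (R t : B →ₗ[ℂ] B) hpos h1 (b - t • T b)
      (hb.sub (by rw [IsSelfAdjoint, star_smul, ← hstar, hb.star_eq, star_trivial t]))
    simp only [ContinuousLinearMap.coe_coe, i1] at hk
    rw [← sub_nonneg] at hk
    rw [← i1 (b * b), ← map_sub] at hk
    rw [← ContinuousLinearMap.map_smul_of_tower]
    convert hk using 2
    rw [hY, hZ]
    simp only [sub_mul, mul_sub, smul_add, smul_sub, smul_mul_assoc, mul_smul_comm]
    abel
  have hY1 : 0 ≤ Y := by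
    refine ge_of_tendsto (hg.mono_left (nhdsWithin_le_nhds (s := Set.Ioi 0))) ?_
    filter_upwards [nhdsWithin_le_nhds key, self_mem_nhdsWithin] with t ht ht0
    have ht0' : 0 < t := ht0
    have := smul_nonneg (inv_nonneg.2 ht0'.le) ht
    rwa [smul_smul, inv_mul_cancel₀ ht0'.ne', one_smul] at this
  have hY2 : Y ≤ 0 := by
    refine le_of_tendsto (hg.mono_left (nhdsWithin_le_nhds (s := Set.Iio 0))) ?_
    filter_upwards [nhdsWithin_le_nhds key, self_mem_nhdsWithin] with t ht ht0
    have ht0' : t < 0 := ht0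
    have := smul_nonneg (a := (-t)⁻¹) (inv_nonneg.2 (by linarith)) ht
    rw [smul_smul, inv_neg, neg_mul, inv_mul_cancel₀ ht0'.ne, neg_smul, one_smul, neg_nonneg] at this
    exact this
  exact sub_eq_zero.1 (hY ▸ le_antisymm hY2 hY1)

theorem wl_star_case (T : B →ₗ[ℂ] B)
    (hstar : ∀ x, T (star x) = star (T x))
    (h1 : ∀ φ : B →L[ℂ] ℂ, IsState φ → φ (T 1) = 0)
    (hP : ∀ b, 0 ≤ b → ∀ φ : B →L[ℂ] ℂ, IsState φ → φ b = 0 → φ (T b) = 0) :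
    ∀ a b, T (a * b) = T a * b + a * T b := by
  rcases subsingleton_or_nontrivial B with hB | hB
  · intro a b; exact Subsingleton.elim _ _
  have hT1 := wl_T_one T hstar h1
  have J := wl_jordan_sa T hT1 hstar hP
  have J2 : ∀ x y : B, IsSelfAdjoint x → IsSelfAdjoint y →
      T (x * y) + T (y * x) = T x * y + x * T y + T y * x + y * T x := by
    intro x y hx hy
    have h := J (x + y) (hx.add hy)
    have e : (x + y) * (x + y) = x * x + y * y + (x * y + y * x) := by noncomm_ring
    rw [e, map_add, map_add, J x hx, J y hy, map_add, map_add] at h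
    rw [eq_sub_of_add_eq' h]; noncomm_ring
  apply wl_jordan T (map_add T)
  · intro a
    obtain ⟨x, y, hx, hy, rfl⟩ : ∃ x y : B, IsSelfAdjoint x ∧ IsSelfAdjoint y ∧
        a = x + Complex.I • y :=
      ⟨realPart a, imaginaryPart a, (realPart a).2, (imaginaryPart a).2,
        (realPart_add_I_smul_imaginaryPart a).symm⟩
    have e : (x + Complex.I • y) * (x + Complex.I • y)
        = x * x - y * y + Complex.I • (x * y + y * x) := by
      simp only [add_mul, mul_add, smul_mul_assoc, mul_smul_comm, smul_smul, Complex.I_mul_I,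
        smul_add, neg_smul, one_smul]
      abel
    rw [e, map_add, map_sub, map_smul, map_add, J x hx, J y hy, J2 x y hx hy, map_add, map_smul]
    simp only [add_mul, mul_add, smul_mul_assoc, mul_smul_comm, smul_smul, Complex.I_mul_I,
        smul_add, neg_smul, one_smul]
    abel
  · intro a h
    rw [← two_smul ℂ] at h
    rcases smul_eq_zero.1 h with h | h
    · norm_num at h
    · exact h
  · intro a h
    have h1 := h (star a)
    have h2 : star (star a * a) * (star a * a) = 0 := by
      rw [star_mul, star_star, mul_assoc, ← mul_assoc a, h1, mul_zero]
    exact CStarRing.star_mul_self_eq_zero_iff _ |>.1 (CStarRing.star_mul_self_eq_zero_iff _ |>.1 h2)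

end Main

section Final
variable {B : Type*} [CStarAlgebra B] [PartialOrder B] [StarOrderedRing B]

theorem wl_map_star (φ : B →L[ℂ] ℂ) (hφ : IsState φ) (x : B) : φ (star x) = star (φ x) := by
  have hpos : ∀ x, 0 ≤ x → 0 ≤ φ x := by
    intro x hx
    obtain ⟨c, rfl⟩ := CStarAlgebra.nonneg_iff_eq_star_mul_self.1 hx
    exact hφ.2 c
  let f : B →ₚ[ℂ] ℂ := PositiveLinearMap.mk₀ (φ : B →ₗ[ℂ] ℂ) hpos
  exact map_star f x

theorem wl_final (T : B → B) (hT : IsWeakLocalDerivation T) :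
    ∀ a b : B, T (a * b) = T a * b + a * T b := by
  obtain ⟨hlin, hloc⟩ := hT
  have hP : ∀ b, 0 ≤ b → ∀ φ : B →L[ℂ] ℂ, IsState φ → φ b = 0 → φ (T b) = 0 := by
    intro b hb φ hφ h0
    obtain ⟨D, hD, h⟩ := hloc b φ hφ
    have hs : IsSelfAdjoint (CFC.sqrt b) := .of_nonneg (CFC.sqrt_nonneg b)
    have hss : CFC.sqrt b * CFC.sqrt b = b := CFC.sqrt_mul_sqrt_self b hb
    have cs := wl_CS φ hφ.2 (CFC.sqrt b) (by rw [hs.star_eq, hss, h0])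
    rw [h]
    nth_rewrite 1 [← hss]
    have h2 := (cs (D (CFC.sqrt b))).2
    rw [hs.star_eq] at h2
    rw [hD.2, map_add, (cs _).1, h2, add_zero]
  have h1 : ∀ φ : B →L[ℂ] ℂ, IsState φ → φ (T 1) = 0 := by
    intro φ hφ
    obtain ⟨D, hD, h⟩ := hloc 1 φ hφ
    have hD1 : D 1 = 0 := by
      have := hD.2 1 1
      simpa using this
    rw [h, hD1, map_zero]
  let T₀ : B →ₗ[ℂ] B := hlin.mk' T
  have hT₀ : ∀ x, T₀ x = T x := fun _ => rfl
  let T' : B →ₗ[ℂ] B :=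
    { toFun := fun x => star (T (star x))
      map_add' := fun x y => by rw [star_add, hlin.map_add, star_add]
      map_smul' := fun c x => by rw [star_smul, hlin.map_smul, star_smul, star_star]; rfl }
  have hT' : ∀ x, T' x = star (T (star x)) := fun _ => rfl
  have hP' : ∀ b, 0 ≤ b → ∀ φ : B →L[ℂ] ℂ, IsState φ → φ b = 0 → φ (T' b) = 0 := by
    intro b hb φ hφ h0
    rw [hT', wl_map_star φ hφ, (IsSelfAdjoint.of_nonneg hb).star_eq, hP b hb φ hφ h0, star_zero]
  have h1' : ∀ φ : B →L[ℂ] ℂ, IsState φ → φ (T' 1) = 0 := by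
    intro φ hφ
    rw [hT', wl_map_star φ hφ, star_one, h1 φ hφ, star_zero]
  have d1 := wl_star_case (T₀ + T')
    (fun x => by
      simp only [LinearMap.add_apply, hT₀, hT', star_add, star_star]
      exact add_comm _ _)
    (fun φ hφ => by rw [LinearMap.add_apply, map_add, hT₀, h1 φ hφ, h1' φ hφ, add_zero])
    (fun b hb φ hφ h0 => by
      rw [LinearMap.add_apply, map_add, hT₀, hP b hb φ hφ h0, hP' b hb φ hφ h0, add_zero])
  have d2 := wl_star_case (Complex.I • (T₀ - T'))
    (fun x => by
      simp only [LinearMap.smul_apply, LinearMap.sub_apply, hT₀, hT', star_smul, star_sub,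
        star_star, Complex.star_def, Complex.conj_I, neg_smul, ← smul_neg, neg_sub])
    (fun φ hφ => by
      rw [LinearMap.smul_apply, LinearMap.sub_apply, map_smul, map_sub, hT₀, h1 φ hφ, h1' φ hφ,
        sub_zero, smul_zero])
    (fun b hb φ hφ h0 => by
      rw [LinearMap.smul_apply, LinearMap.sub_apply, map_smul, map_sub, hT₀, hP b hb φ hφ h0,
        hP' b hb φ hφ h0, sub_zero, smul_zero])
  intro a b
  have e1 := d1 a b
  have e2 := d2 a b
  simp only [LinearMap.smul_apply, LinearMap.sub_apply, smul_mul_assoc, mul_smul_comm,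
    ← smul_add] at e2
  have e3 := smul_right_injective B Complex.I_ne_zero e2
  simp only [LinearMap.add_apply] at e1
  have e4 : (2 : ℂ) • T₀ (a * b) = (2 : ℂ) • (T₀ a * b + a * T₀ b) := by
    have h := congrArg₂ (· + ·) e1 e3
    simp only [two_smul]
    have l : T₀ (a * b) + T₀ (a * b)
      = T₀ (a * b) + T' (a * b) + (T₀ (a * b) - T' (a * b)) := by abel
    rw [l]
    refine h.trans ?_
    noncomm_ring
  exact smul_right_injective B two_ne_zero e4
end Final

/-- Every weak-local derivation on a C*-algebra is a derivation. -/
theorem weakLocalDerivation_is_derivation (T : A → A) (hT : IsWeakLocalDerivation T) :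
    ∀ a b : A, T (a * b) = T a * b + a * T b := by
  letI : CStarAlgebra A := {}
  letI : PartialOrder A := CStarAlgebra.spectralOrder A
  haveI : StarOrderedRing A := CStarAlgebra.spectralOrderedRing A
  exact wl_final T hT
end
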